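/- arXiv:1105.2348 — 2 statements merged into one kernel-verified Lean document; each statement's English description precedes it below -/
import Mathlib

section
/- The third homotopy group of the 2-sphere is isomorphic to the integers: π₃(S²) ≅ ℤ. -/
noncomputable section
open scoped Manifold Topology
open Metric Set

/-- Euclidean 3-space. -/
abbrev E3 := EuclideanSpace ℝ (Fin 3)
/-- Euclidean 2-space. -/
abbrev E2 := EuclideanSpace ℝ (Fin 2)

instance : Fact (Module.finrank ℝ E3 = 2 + 1) := ⟨by simp⟩

/-- The 2-sphere `S²`, as the unit sphere in `ℝ³`. -/
abbrev Sph2 := Metric.sphere (0 : E3) 1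

namespace HopfPf
open scoped unitInterval Quaternion Topology.Homotopy

/-! ## Part 1: extension, selection and general position in the quaternions -/

/-- The real quaternions. -/
abbrev HH := Quaternion ℝ

/-- Quaternions off the nonpositive real ray. -/
def Up : Set HH := {q | q.im ≠ 0 ∨ 0 < q.re}
/-- Quaternions off the nonnegative real ray. -/
def Um : Set HH := {q | q.im ≠ 0 ∨ q.re < 0}

lemma isOpen_Up : IsOpen Up :=
  (isOpen_ne.preimage Quaternion.continuous_im).union
    (isOpen_lt continuous_const Quaternion.continuous_re)

lemma isOpen_Um : IsOpen Um :=
  (isOpen_ne.preimage Quaternion.continuous_im).union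
    (isOpen_lt Quaternion.continuous_re continuous_const)

lemma one_mem_Up : (1 : HH) ∈ Up := Or.inr (by simp)
lemma neg_one_mem_Um : (-1 : HH) ∈ Um := Or.inr (by simp)

lemma star_Up : StarConvex ℝ (1 : HH) Up := by
  intro y hy a b ha hb hab
  by_cases hi : y.im = 0
  · have hy' : 0 < y.re := hy.resolve_left (by simpa using hi)
    right
    simp only [Quaternion.re_add, Quaternion.re_smul, Quaternion.re_one, smul_eq_mul, mul_one]
    rcases ha.eq_or_lt with h | h
    · have : b = 1 := by linarith
      subst this; linarith
    · have := mul_nonneg hb hy'.le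
      linarith
  · rcases hb.eq_or_lt with h | h
    · right
      have : a = 1 := by linarith
      simp [← h, this]
    · left
      simp only [Quaternion.im_add, Quaternion.im_smul, Quaternion.im_one, smul_zero, zero_add]
      exact smul_ne_zero h.ne' hi

lemma neg_mem_Um {q : HH} : -q ∈ Um ↔ q ∈ Up := by
  simp [Up, Um]

lemma star_Um : StarConvex ℝ (-1 : HH) Um := by
  intro y hy a b ha hb hab
  have h1 : -y ∈ Up := by rw [← neg_mem_Um]; simpa using hy
  have := star_Up h1 ha hb hab
  rw [← neg_mem_Um] at this
  convert this using 1
  simp only [smul_neg, neg_add_rev, neg_neg]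
  abel

lemma mem_Up_ne {q : HH} (h : q ∈ Up) : q ≠ 0 := by
  rintro rfl; simp [Up] at h
lemma mem_Um_ne {q : HH} (h : q ∈ Um) : q ≠ 0 := by
  rintro rfl; simp [Um] at h
lemma im_ne_of_mem {q : HH} (h : q ∈ Up) (h' : q ∈ Um) : q.im ≠ 0 := by
  rcases h with h | h
  · exact h
  · rcases h' with h' | h'
    · exact h'
    · exact absurd h' (not_lt.2 h.le)

/-- Star-shaped open sets are absolute extensors. -/
lemma star_ext {Z : Type} [TopologicalSpace Z] [NormalSpace Z] {A : Set Z} (hA : IsClosed A)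
    {U : Set HH} (hU : IsOpen U) {e : HH} (he : e ∈ U) (hs : StarConvex ℝ e U) (φ : Z → HH)
    (hφ : ContinuousOn φ A) (hm : ∀ z ∈ A, φ z ∈ U) :
    ∃ ψ : C(Z, HH), (∀ z, ψ z ∈ U) ∧ ∀ z ∈ A, ψ z = φ z := by
  obtain ⟨g, hg⟩ := ContinuousMap.exists_restrict_eq hA ⟨A.domRestrict φ, hφ.domRestrict⟩
  have hg' : ∀ z ∈ A, g z = φ z := fun z hz => by
    exact congrArg (fun k : C(A, HH) => k ⟨z, hz⟩) hg
  have hB : IsClosed (g ⁻¹' Uᶜ) := hU.isClosed_compl.preimage g.continuous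
  have hd : Disjoint (g ⁻¹' Uᶜ) A := by
    rw [Set.disjoint_left]
    intro z hz hzA
    exact hz (by rw [hg' z hzA]; exact hm z hzA)
  obtain ⟨χ, h0, h1, h01⟩ := exists_continuous_zero_one_of_isClosed hB hA hd
  refine ⟨⟨fun z => (1 - χ z) • e + χ z • g z, by fun_prop⟩, fun z => ?_, fun z hz => ?_⟩
  · simp only [ContinuousMap.coe_mk]
    by_cases hz : g z ∈ U
    · exact hs hz (by linarith [(h01 z).2]) (h01 z).1 (by ring)
    · have : χ z = 0 := h0 hz
      simpa [this] using he
  · have : χ z = 1 := h1 hz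
    simp [this, hg' z hz]

/-- The midpoint of the unit interval. -/
def half : I := ⟨1 / 2, by constructor <;> norm_num⟩

lemma susp_ext {T : Type} [TopologicalSpace T] [NormalSpace (I × T)] {L : Set (I × T)}
    (hL : IsClosed L) (hh : ∀ t, (half, t) ∈ L) (φ : I × T → HH) (hφ : ContinuousOn φ L)
    (h1 : ∀ p ∈ L, p.1 ≤ half → φ p ∈ Up) (h2 : ∀ p ∈ L, half ≤ p.1 → φ p ∈ Um) :
    ∃ F : C(I × T, HH), (∀ p ∈ L, F p = φ p) ∧ (∀ p, p.1 ≤ half → F p ∈ Up) ∧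
      (∀ p, half ≤ p.1 → F p ∈ Um) := by
  have c1 : IsClosed {p : I × T | p.1 ≤ half} := isClosed_le continuous_fst continuous_const
  have c2 : IsClosed {p : I × T | half ≤ p.1} := isClosed_le continuous_const continuous_fst
  obtain ⟨ψ1, a1, b1⟩ := star_ext (hL.inter c1) isOpen_Up one_mem_Up star_Up φ
    (hφ.mono inter_subset_left) (fun z hz => h1 z hz.1 hz.2)
  obtain ⟨ψ2, a2, b2⟩ := star_ext (hL.inter c2) isOpen_Um neg_one_mem_Um star_Um φ
    (hφ.mono inter_subset_left) (fun z hz => h2 z hz.1 hz.2)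
  have hag : ∀ p : I × T, p.1 = half → ψ1 p = ψ2 p := by
    rintro ⟨s, t⟩ rfl
    rw [b1 (half, t) ⟨hh t, le_refl half⟩, b2 (half, t) ⟨hh t, le_refl half⟩]
  refine ⟨⟨fun p => if p.1 ≤ half then ψ1 p else ψ2 p,
    Continuous.if_le ψ1.continuous ψ2.continuous continuous_fst continuous_const hag⟩,
    fun p hp => ?_, fun p hp => ?_, fun p hp => ?_⟩
  · simp only [ContinuousMap.coe_mk]
    split_ifs with h
    · exact b1 _ ⟨hp, h⟩
    · exact b2 _ ⟨hp, (not_le.1 h).le⟩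
  · simp only [ContinuousMap.coe_mk, hp, if_true]
    exact a1 p
  · simp only [ContinuousMap.coe_mk]
    split_ifs with h
    · rw [hag p (le_antisymm h hp)]; exact a2 p
    · exact a2 p

/-- Continuous selection of a splitting height. -/
lemma select {T : Type} [TopologicalSpace T] [NormalSpace T] [ParacompactSpace T]
    (F : C(I × T, HH))
    (H : ∀ t, ∃ v : I, (∀ s ≤ v, F (s, t) ∈ Up) ∧ (∀ s, v ≤ s → F (s, t) ∈ Um)) :
    ∃ τ : C(T, I), ∀ t, (∀ s ≤ τ t, F (s, t) ∈ Up) ∧ (∀ s, τ t ≤ s → F (s, t) ∈ Um) := by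
  let S : T → Set ℝ := fun t => {v | v ∈ Icc (0 : ℝ) 1 ∧
    (∀ s : I, (s : ℝ) ≤ v → F (s, t) ∈ Up) ∧ (∀ s : I, v ≤ s → F (s, t) ∈ Um)}
  have hconv : ∀ t, Convex ℝ (S t) := by
    intro t x hx y hy a b ha hb hab
    refine ⟨(convex_Icc (0 : ℝ) 1) hx.1 hy.1 ha hb hab, fun s hs => ?_, fun s hs => ?_⟩
    · rcases le_total x y with h | h
      · refine hy.2.1 s (hs.trans ?_)
        have := Convex.min_le_combo x y ha hb hab
        have := Convex.combo_le_max x y ha hb hab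
        rwa [max_eq_right h] at this
      · refine hx.2.1 s (hs.trans ?_)
        have := Convex.combo_le_max x y ha hb hab
        rwa [max_eq_left h] at this
    · rcases le_total x y with h | h
      · refine hx.2.2 s (le_trans ?_ hs)
        have := Convex.min_le_combo x y ha hb hab
        rwa [min_eq_left h] at this
      · refine hy.2.2 s (le_trans ?_ hs)
        have := Convex.min_le_combo x y ha hb hab
        rwa [min_eq_right h] at this
  obtain ⟨g, hg⟩ := exists_continuous_forall_mem_convex_of_local_const hconv (fun t => by
    obtain ⟨v, hv1, hv2⟩ := H t
    refine ⟨v, ?_⟩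
    have e1 : ∀ᶠ t' in 𝓝 t, ∀ s ∈ {s : I | s ≤ v}, F (s, t') ∈ Up := by
      apply IsCompact.eventually_forall_of_forall_eventually
      · exact (isClosed_le continuous_id continuous_const).isCompact
      · intro s hs
        have : Continuous fun z : T × I => F (z.2, z.1) := by fun_prop
        exact this.continuousAt.eventually (isOpen_Up.mem_nhds (hv1 s hs))
    have e2 : ∀ᶠ t' in 𝓝 t, ∀ s ∈ {s : I | v ≤ s}, F (s, t') ∈ Um := by
      apply IsCompact.eventually_forall_of_forall_eventually
      · exact (isClosed_le continuous_const continuous_id).isCompact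
      · intro s hs
        have : Continuous fun z : T × I => F (z.2, z.1) := by fun_prop
        exact this.continuousAt.eventually (isOpen_Um.mem_nhds (hv2 s hs))
    filter_upwards [e1, e2] with t' h1 h2
    exact ⟨v.2, fun s hs => h1 s hs, fun s hs => h2 s hs⟩)
  exact ⟨⟨fun t => ⟨g t, (hg t).1⟩, by fun_prop⟩, fun t => ⟨fun s hs => (hg t).2.1 s hs,
    fun s hs => (hg t).2.2 s hs⟩⟩

lemma norm_sq_im (q : HH) : ‖q‖ * ‖q‖ = q.re * q.re + ‖q.im‖ * ‖q.im‖ := by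
  rw [← Quaternion.normSq_eq_norm_mul_self, ← Quaternion.normSq_eq_norm_mul_self]
  simp only [Quaternion.normSq_def', Quaternion.re_im, Quaternion.imI_im, Quaternion.imJ_im,
    Quaternion.imK_im]
  ring

lemma norm_im_le (q : HH) : ‖q.im‖ ≤ ‖q‖ := by
  have := norm_sq_im q
  nlinarith [norm_nonneg q, norm_nonneg q.im, mul_self_nonneg q.re]

lemma abs_re_le (q : HH) : |q.re| ≤ ‖q‖ := by
  have := norm_sq_im q
  apply abs_le_of_sq_le_sq _ (norm_nonneg q)
  nlinarith [norm_nonneg q, norm_nonneg q.im]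

lemma norm_le_re_im (q : HH) : ‖q‖ ≤ |q.re| + ‖q.im‖ := by
  have := norm_sq_im q
  have h2 := abs_mul_abs_self q.re
  nlinarith [norm_nonneg q, norm_nonneg q.im, abs_nonneg q.re,
    mul_nonneg (abs_nonneg q.re) (norm_nonneg q.im)]

/-- Clamp a real number to the unit interval. -/
def clamp (x : ℝ) : ℝ := max 0 (min 1 x)
lemma clamp_nonneg (x : ℝ) : 0 ≤ clamp x := le_max_left _ _
lemma clamp_le_one (x : ℝ) : clamp x ≤ 1 := max_le zero_le_one (min_le_left _ _)
lemma clamp_of_one_le {x : ℝ} (h : 1 ≤ x) : clamp x = 1 := by simp [clamp, h]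
lemma clamp_of_nonpos {x : ℝ} (h : x ≤ 0) : clamp x = 0 := by
  simp [clamp, h]
lemma continuous_clamp : Continuous clamp := by unfold clamp; fun_prop

lemma exists_norm_lb {D : Type} [TopologicalSpace D] [CompactSpace D] (f : C(D, HH))
    (hf : ∀ d, f d ≠ 0) : ∃ m > 0, ∀ d, m ≤ ‖f d‖ := by
  rcases isEmpty_or_nonempty D with h | h
  · exact ⟨1, one_pos, fun d => (h.false d).elim⟩
  · obtain ⟨d, -, hd⟩ := isCompact_univ.exists_isMinOn (univ_nonempty (α := D))
      (f.continuous.norm).continuousOn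
    exact ⟨‖f d‖, norm_pos_iff.2 (hf d), fun x => hd (mem_univ x)⟩

lemma gp0 {D : Type} [TopologicalSpace D] [CompactSpace D] (f : C(D, HH)) (hf : ∀ d, f d ≠ 0)
    {η : ℝ} (hη : 0 < η) (lam : C(D, I)) :
    ∃ δ > 0, ∀ (h : C(D, HH)) (c d : HH), (∀ x, ‖h x - f x‖ < δ) → c.re = 0 → d.re = 0 →
      ‖c‖ < δ → ‖d‖ < δ → ∃ f' : C(D, HH), (∀ x, ‖f' x - f x‖ < η) ∧
        (∀ x, (f x).re = 0 → f' x = f x) ∧ (∀ x, lam x = 0 → f' x = f x) ∧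
        (∀ x, lam x = 1 → (f' x).im = 0 → 0 < (f' x).re → (h x).im = c) ∧
        (∀ x, lam x = 1 → (f' x).im = 0 → (f' x).re < 0 → (h x).im = d) := by
  obtain ⟨m, hm, hmf⟩ := exists_norm_lb f hf
  obtain ⟨ε, hε, hεm, hεη⟩ : ∃ ε > 0, 3 * ε ≤ m ∧ ε ≤ η :=
    ⟨min (m / 3) η, lt_min (by positivity) hη, by linarith [min_le_left (m / 3) η],
      min_le_right _ _⟩
  refine ⟨ε / 4, by positivity, fun h c d hh hc hd hcn hdn => ?_⟩
  let χ : ℝ → HH → ℝ := fun sg q => clamp (2 - ‖q.im‖ / ε) * clamp (sg * q.re / ε)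
  have hχc : ∀ sg, Continuous (χ sg) := by
    intro sg
    have h1 := Quaternion.continuous_im
    have h2 := Quaternion.continuous_re
    exact (continuous_clamp.comp (by fun_prop)).mul (continuous_clamp.comp (by fun_prop))
  have hχ0 : ∀ sg q, 0 ≤ χ sg q := fun sg q => mul_nonneg (clamp_nonneg _) (clamp_nonneg _)
  have hχ1 : ∀ sg q, χ sg q ≤ 1 := fun sg q =>
    mul_le_one₀ (clamp_le_one _) (clamp_nonneg _) (clamp_le_one _)
  let f' : C(D, HH) := ⟨fun x => f x + ((lam x : ℝ) * χ 1 (f x)) • (h x - c - f x) +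
    ((lam x : ℝ) * χ (-1) (f x)) • (h x - d - f x), by
      have := hχc 1; have := hχc (-1); fun_prop⟩
  have hf' : ∀ x, f' x = f x + ((lam x : ℝ) * χ 1 (f x)) • (h x - c - f x) +
    ((lam x : ℝ) * χ (-1) (f x)) • (h x - d - f x) := fun x => rfl
  have hb : ∀ sg x (c : HH), ‖c‖ < ε / 4 →
      ‖((lam x : ℝ) * χ sg (f x)) • (h x - c - f x)‖ < ε / 2 := by
    intro sg x c hc
    have h1 : ‖h x - c - f x‖ < ε / 2 := by
      calc ‖h x - c - f x‖ = ‖(h x - f x) - c‖ := by congr 1; abel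
        _ ≤ ‖h x - f x‖ + ‖c‖ := norm_sub_le _ _
        _ < ε / 2 := by linarith [hh x]
    have h2 : 0 ≤ (lam x : ℝ) * χ sg (f x) := mul_nonneg (lam x).2.1 (hχ0 _ _)
    have h3 : (lam x : ℝ) * χ sg (f x) ≤ 1 := mul_le_one₀ (lam x).2.2 (hχ0 _ _) (hχ1 _ _)
    rw [norm_smul, Real.norm_of_nonneg h2]
    calc _ ≤ 1 * ‖h x - c - f x‖ := by gcongr
      _ < ε / 2 := by linarith
  have hclose : ∀ x, ‖f' x - f x‖ < ε := by
    intro x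
    rw [hf', add_assoc, add_sub_cancel_left]
    exact (norm_add_le _ _).trans_lt (by linarith [hb 1 x c hcn, hb (-1) x d hdn])
  have key : ∀ x, (f' x).im = 0 → 2 * ε < |(f x).re| ∧ ‖(f x).im‖ < ε ∧
      |(f' x).re - (f x).re| < ε := by
    intro x hx
    have h1 : ‖(f x).im‖ < ε := by
      have := norm_im_le (f' x - f x)
      rw [Quaternion.im_sub, hx, zero_sub, norm_neg] at this
      exact this.trans_lt (hclose x)
    have h2 := norm_le_re_im (f x)
    have h3 := hmf x
    refine ⟨by linarith, h1, ?_⟩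
    have := abs_re_le (f' x - f x)
    rw [Quaternion.re_sub] at this
    exact this.trans_lt (hclose x)
  have hcl : ∀ x, ‖(f x).im‖ < ε → clamp (2 - ‖(f x).im‖ / ε) = 1 := by
    intro x hx
    apply clamp_of_one_le
    have : ‖(f x).im‖ / ε ≤ 1 := by rw [div_le_one hε]; exact hx.le
    linarith
  refine ⟨f', fun x => (hclose x).trans_le hεη, fun x hx => ?_, fun x hx => ?_,
    fun x hl hi hr => ?_, fun x hl hi hr => ?_⟩
  · simp [hf', χ, hx, clamp_of_nonpos]
  · simp [hf', hx]
  · obtain ⟨k1, k2, k3⟩ := key x hi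
    rw [abs_lt] at k3
    have k4 : 2 * ε < (f x).re := by
      rcases abs_cases (f x).re with ⟨h, _⟩ | ⟨h, _⟩ <;> linarith
    have e1 : χ 1 (f x) = 1 := by
      simp only [χ, hcl x k2, one_mul]
      exact clamp_of_one_le (by rw [one_le_div hε]; linarith)
    have e2 : χ (-1) (f x) = 0 := by
      simp only [χ, hcl x k2, one_mul]
      exact clamp_of_nonpos (div_nonpos_of_nonpos_of_nonneg (by linarith) hε.le)
    have e3 : f' x = h x - c := by
      rw [hf', hl, e1, e2]; simp
    rw [e3, Quaternion.im_sub] at hi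
    rw [sub_eq_zero.1 hi]
    ext <;> simp [hc]
  · obtain ⟨k1, k2, k3⟩ := key x hi
    rw [abs_lt] at k3
    have k4 : 2 * ε < -(f x).re := by
      rcases abs_cases (f x).re with ⟨h, _⟩ | ⟨h, _⟩ <;> linarith
    have e1 : χ (-1) (f x) = 1 := by
      simp only [χ, hcl x k2, one_mul]
      exact clamp_of_one_le (by rw [one_le_div hε]; linarith)
    have e2 : χ 1 (f x) = 0 := by
      simp only [χ, hcl x k2, one_mul]
      exact clamp_of_nonpos (div_nonpos_of_nonpos_of_nonneg (by linarith) hε.le)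
    have e3 : f' x = h x - d := by
      rw [hf', hl, e1, e2]; simp
    rw [e3, Quaternion.im_sub] at hi
    rw [sub_eq_zero.1 hi]
    ext <;> simp [hd]

/-- The imaginary coordinates, as a linear map. -/
def kap : HH →ₗ[ℝ] ℝ × ℝ × ℝ where
  toFun q := (q.imI, q.imJ, q.imK)
  map_add' _ _ := by simp
  map_smul' _ _ := by simp

/-- The imaginary quaternion with given coordinates. -/
def kinv : (ℝ × ℝ × ℝ) →ₗ[ℝ] HH where
  toFun c := ⟨0, c.1, c.2.1, c.2.2⟩
  map_add' _ _ := QuaternionAlgebra.ext (add_zero (0 : ℝ)).symm rfl rfl rfl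
  map_smul' r _ := QuaternionAlgebra.ext (mul_zero r).symm rfl rfl rfl

lemma kap_of_im {q : HH} {c} (h : q.im = kinv c) : kap q = c := by
  have h1 : q.imI = c.1 := congrArg (fun x : HH => x.imI) h
  have h2 : q.imJ = c.2.1 := congrArg (fun x : HH => x.imJ) h
  have h3 : q.imK = c.2.2 := congrArg (fun x : HH => x.imK) h
  exact Prod.ext h1 (Prod.ext h2 h3)

lemma contDiff_kap : ContDiff ℝ 1 kap := (LinearMap.toContinuousLinearMap kap).contDiff

lemma smooth_approx {D V : Type} [TopologicalSpace D] [NormedAddCommGroup V]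
    [NormedSpace ℝ V] [FiniteDimensional ℝ V] {ι : D → V} (hι : Topology.IsClosedEmbedding ι)
    (f : C(D, HH)) {δ : ℝ} (hδ : 0 < δ) :
    ∃ h : V → HH, ContDiff ℝ 1 h ∧ ∀ x, ‖h (ι x) - f x‖ < δ := by
  obtain ⟨g, hg⟩ := ContinuousMap.exists_extension' hι f
  obtain ⟨h, h1, h2, -⟩ := g.continuous.exists_contDiff_approx (ε := fun _ => δ) 1
    continuous_const (fun _ => hδ)
  refine ⟨h, h1, fun x => ?_⟩
  have := h2 (ι x)
  rw [dist_eq_norm] at this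
  have e : g (ι x) = f x := congrFun hg x
  rwa [e] at this

lemma kinv_small {δ : ℝ} (hδ : 0 < δ) : {c : ℝ × ℝ × ℝ | ‖kinv c‖ < δ} ∈ 𝓝 0 := by
  have : Continuous fun c => ‖kinv c‖ := (LinearMap.toContinuousLinearMap kinv).continuous.norm
  exact (isOpen_lt this continuous_const).mem_nhds (by simpa using hδ)

/-- Maps from low dimensional spaces can be pushed off the real axis. -/
lemma gp_low {D V : Type} [TopologicalSpace D] [CompactSpace D] [NormedAddCommGroup V]
    [NormedSpace ℝ V] [FiniteDimensional ℝ V] (hV : Module.finrank ℝ V < 3)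
    {ι : D → V} (hι : Topology.IsClosedEmbedding ι) (f : C(D, HH)) (hf : ∀ d, f d ≠ 0) :
    ∃ f' : C(D, HH), (∀ x, ‖f' x - f x‖ < ‖f x‖) ∧
        (∀ x, (f x).re = 0 → f' x = f x) ∧ (∀ x, (f' x).im ≠ 0) := by
  obtain ⟨m, hm, hmf⟩ := exists_norm_lb f hf
  obtain ⟨δ, hδ, H⟩ := gp0 f hf hm (ContinuousMap.const _ 1)
  obtain ⟨h, h1, h2⟩ := smooth_approx hι f hδ
  have hd : Dense (range (fun v => kap (h v)))ᶜ :=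
    (contDiff_kap.comp h1).dense_compl_range_of_finrank_lt_finrank (by simpa using hV)
  obtain ⟨c, hc1, hc2⟩ := hd.inter_nhds_nonempty (kinv_small hδ)
  obtain ⟨f', a1, a2, -, a3, a4⟩ := H ⟨fun x => h (ι x), h1.continuous.comp hι.continuous⟩
    (kinv c) (kinv c) h2 rfl rfl hc2 hc2
  refine ⟨f', fun x => (a1 x).trans_le (hmf x), a2, fun x hx => ?_⟩
  have hne : f' x ≠ 0 := by
    intro h0
    have := a1 x
    rw [h0, zero_sub, norm_neg] at this
    exact absurd (hmf x) (not_le.2 this)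
  have hre : (f' x).re ≠ 0 := by
    intro h0
    apply hne
    rw [← Quaternion.re_add_im (f' x), hx, h0]; simp
  rcases hre.lt_or_gt with h' | h'
  · exact hc1 ⟨ι x, kap_of_im (a4 x rfl hx h')⟩
  · exact hc1 ⟨ι x, kap_of_im (a3 x rfl hx h')⟩

/-- Main general position lemma. -/
lemma gp {T V : Type} [TopologicalSpace T] [CompactSpace T] [NormedAddCommGroup V]
    [NormedSpace ℝ V] [FiniteDimensional ℝ V] (hV : Module.finrank ℝ V < 4)
    {ι : T → V} (hι : Topology.IsClosedEmbedding ι) (f : C(I × T, HH)) (hf : ∀ d, f d ≠ 0)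
    {η : ℝ} (hη : 0 < η) (lam : C(T, I)) :
    ∃ f' : C(I × T, HH), (∀ x, ‖f' x - f x‖ < η) ∧ (∀ x, ‖f' x - f x‖ < ‖f x‖) ∧
        (∀ x, (f x).re = 0 → f' x = f x) ∧ (∀ x, lam x.2 = 0 → f' x = f x) ∧
        (∀ t, lam t = 1 → (∀ s, f' (s, t) ∈ Up) ∨ (∀ s, f' (s, t) ∈ Um)) := by
  obtain ⟨m, hm, hmf⟩ := exists_norm_lb f hf
  obtain ⟨δ, hδ, H⟩ := gp0 f hf (lt_min hη hm) (lam.comp ⟨Prod.snd, continuous_snd⟩)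
  have hι' : Topology.IsClosedEmbedding (fun p : I × T => ((p.1 : ℝ), ι p.2)) :=
    (isClosed_Icc.isClosedEmbedding_subtypeVal).prodMap hι
  obtain ⟨h, h1, h2⟩ := smooth_approx hι' f hδ
  have hsm : ContDiff ℝ 1 (fun v : ℝ × ℝ × V => (kap (h (v.1, v.2.2)), kap (h (v.2.1, v.2.2)))) := by
    apply ContDiff.prodMk
    · exact contDiff_kap.comp (h1.comp (contDiff_fst.prodMk contDiff_snd.snd))
    · exact contDiff_kap.comp (h1.comp (contDiff_snd.fst.prodMk contDiff_snd.snd))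
  have hd := hsm.dense_compl_range_of_finrank_lt_finrank (by simp; omega)
  have hn : {c : (ℝ × ℝ × ℝ) × (ℝ × ℝ × ℝ) | ‖kinv c.1‖ < δ ∧ ‖kinv c.2‖ < δ} ∈ 𝓝 0 :=
    prod_mem_nhds (kinv_small hδ) (kinv_small hδ)
  obtain ⟨⟨c, d⟩, hc1, hc2, hc3⟩ := hd.inter_nhds_nonempty hn
  obtain ⟨f', a1, a2, a5, a3, a4⟩ := H ⟨fun x => h (x.1, ι x.2), h1.continuous.comp hι'.continuous⟩
    (kinv c) (kinv d) h2 rfl rfl hc2 hc3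
  have a1' : ∀ x, ‖f' x - f x‖ < ‖f x‖ := fun x =>
    (a1 x).trans_le ((min_le_right _ _).trans (hmf x))
  refine ⟨f', fun x => (a1 x).trans_le (min_le_left _ _), a1', a2, a5, fun t ht => ?_⟩
  by_contra! hcon
  obtain ⟨⟨s, hs⟩, ⟨s', hs'⟩⟩ := hcon
  have hne : ∀ x, (f' x).im = 0 → (f' x).re ≠ 0 := by
    intro x hx h0
    have h3 := a1' x
    have : f' x = 0 := by rw [← Quaternion.re_add_im (f' x), hx, h0]; simp
    rw [this, zero_sub, norm_neg] at h3
    exact lt_irrefl _ h3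
  simp only [Up, Um, mem_ofPred_eq, not_or, not_not, not_lt] at hs hs'
  have r1 := lt_of_le_of_ne hs.2 (hne _ hs.1)
  have r2 := lt_of_le_of_ne hs'.2 (hne _ hs'.1).symm
  have q1 := a4 (s, t) ht hs.1 r1
  have q2 := a3 (s', t) ht hs'.1 r2
  exact hc1 ⟨((s' : ℝ), (s : ℝ), ι t), Prod.ext (kap_of_im q2) (kap_of_im q1)⟩

end HopfPf

namespace HopfPf
open scoped unitInterval Quaternion Topology.Homotopy

/-! ## Part 2: concrete descriptions of homotopy groups of subsets -/

/-- A relation between groups which is the graph of an isomorphism. -/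
lemma rel_mulEquiv {G H : Type} [Group G] [Group H] (R : G → H → Prop)
    (tot : ∀ g, ∃ h, R g h) (fn : ∀ g h h', R g h → R g h' → h = h')
    (mul : ∀ g g' h h', R g h → R g' h' → R (g * g') (h * h'))
    (surj : ∀ h, ∃ g, R g h) (ker : ∀ g, R g 1 → g = 1) : Nonempty (G ≃* H) := by
  choose F hF using tot
  let φ : G →* H := MonoidHom.mk' F fun a b => fn _ _ _ (hF _) (mul _ _ _ _ (hF a) (hF b))
  refine ⟨MulEquiv.ofBijective φ ⟨?_, fun h => ?_⟩⟩
  · rw [injective_iff_map_eq_one]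
    intro a ha
    apply ker
    have : F a = 1 := ha
    rw [← this]
    exact hF a
  · obtain ⟨g, hg⟩ := surj h
    exact ⟨g, fn _ _ _ (hF g) hg⟩

section loops
variable {W : Type} [TopologicalSpace W] {n : ℕ} (U : Set W) (e : W)

/-- A map of the cube which is a loop in `U`. -/
def IsLoop (f : C(Fin n → I, W)) : Prop :=
  (∀ y, f y ∈ U) ∧ ∀ y ∈ Cube.boundary (Fin n), f y = e

/-- Homotopy of loops in `U`. -/
def IsHtpy (f g : C(Fin n → I, W)) : Prop :=
  ∃ H : C(I × (Fin n → I), W), (∀ y, H (0, y) = f y) ∧ (∀ y, H (1, y) = g y) ∧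
    (∀ p, H p ∈ U) ∧ ∀ t, ∀ y ∈ Cube.boundary (Fin n), H (t, y) = e

variable {U e}

/-- The loop as an element of the loop space of Mathlib. -/
def mkL (he : e ∈ U) (f : C(Fin n → I, W)) (h : IsLoop U e f) :
    Ω^ (Fin n) U (⟨e, he⟩ : U) :=
  ⟨⟨fun y => ⟨f y, h.1 y⟩, by fun_prop⟩, fun y hy => Subtype.ext (h.2 y hy)⟩

/-- The class of a loop. -/
def cls (he : e ∈ U) (f : C(Fin n → I, W)) (h : IsLoop U e f) :
    π_ n U (⟨e, he⟩ : U) := (Quotient.mk _ (mkL he f h) : Quotient (GenLoop.Homotopic.setoid _ _))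

lemma exists_cls (he : e ∈ U) (a : π_ n U (⟨e, he⟩ : U)) : ∃ f h, a = cls he f h := by
  induction a using Quotient.inductionOn with
  | h p =>
    refine ⟨⟨fun y => (p y : W), by fun_prop⟩, ⟨fun y => (p y).2, fun y hy => ?_⟩, ?_⟩
    · exact congrArg Subtype.val (p.2 y hy)
    · rfl

lemma cls_eq {he : e ∈ U} {f g : C(Fin n → I, W)} {hf : IsLoop U e f} {hg : IsLoop U e g} :
    cls he f hf = cls he g hg ↔ IsHtpy U e f g := by
  unfold cls
  constructor
  · intro h
    obtain ⟨H⟩ := Quotient.exact h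
    refine ⟨⟨fun p => (H p : W), by fun_prop⟩, fun y => ?_, fun y => ?_, fun p => (H p).2,
      fun t y hy => ?_⟩
    · exact congrArg Subtype.val (H.apply_zero y)
    · exact congrArg Subtype.val (H.apply_one y)
    · exact (congrArg Subtype.val (H.eq_fst t hy)).trans (hf.2 y hy)
  · rintro ⟨H, h0, h1, h2, h3⟩
    apply Quotient.sound
    refine ⟨⟨⟨⟨fun p => ⟨H p, h2 p⟩, by fun_prop⟩, fun y => Subtype.ext (h0 y),
      fun y => Subtype.ext (h1 y)⟩, fun t y hy => Subtype.ext ?_⟩⟩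
    exact (h3 t y hy).trans (hf.2 y hy).symm

lemma IsHtpy.trans {f g k : C(Fin n → I, W)} (he : e ∈ U) (hf : IsLoop U e f) (hg : IsLoop U e g)
    (hk : IsLoop U e k) (h1 : IsHtpy U e f g) (h2 : IsHtpy U e g k) : IsHtpy U e f k := by
  rw [← cls_eq (he := he) (hf := hf) (hg := hg)] at h1
  rw [← cls_eq (he := he) (hf := hg) (hg := hk)] at h2
  rw [← cls_eq (he := he) (hf := hf) (hg := hk), h1, h2]

lemma IsHtpy.symm {f g : C(Fin n → I, W)} (he : e ∈ U) (hf : IsLoop U e f) (hg : IsLoop U e g)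
    (h1 : IsHtpy U e f g) : IsHtpy U e g f := by
  rw [← cls_eq (he := he) (hf := hf) (hg := hg)] at h1
  rw [← cls_eq (he := he) (hf := hg) (hg := hf), h1]

lemma isLoop_const (he : e ∈ U) : IsLoop U e (ContinuousMap.const (Fin n → I) e) :=
  ⟨fun _ => he, fun _ _ => rfl⟩

lemma cls_const (he : e ∈ U) :
    cls he (ContinuousMap.const (Fin (n + 1) → I) e) (isLoop_const he) = 1 := by
  rw [HomotopyGroup.one_def]; rfl

/-- First half of the doubling of the interval. -/
def d0 (s : I) : I := projIcc 0 1 zero_le_one (2 * (s : ℝ))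
/-- Second half of the doubling of the interval. -/
def d1 (s : I) : I := projIcc 0 1 zero_le_one (2 * (s : ℝ) - 1)
lemma continuous_d0 : Continuous d0 := continuous_projIcc.comp (by fun_prop)
lemma continuous_d1 : Continuous d1 := continuous_projIcc.comp (by fun_prop)
@[simp] lemma d0_zero : d0 0 = 0 := by simp [d0]
@[simp] lemma d0_half : d0 half = 1 := by simp [d0, half]
@[simp] lemma d1_half : d1 half = 0 := by simp [d1, half]
@[simp] lemma d1_one : d1 1 = 1 := by simp only [d1, Icc.coe_one]; norm_num

/-- `k` is the concatenation of `f` and `g` along coordinate `i`. -/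
def IsCat (i : Fin n) (f g k : (Fin n → I) → W) : Prop :=
  ∀ y, (y i ≤ half → k y = f (Function.update y i (d0 (y i)))) ∧
    (half ≤ y i → k y = g (Function.update y i (d1 (y i))))

lemma bdry_update_zero (y : Fin n → I) (i : Fin n) :
    Function.update y i 0 ∈ Cube.boundary (Fin n) := ⟨i, by simp⟩
lemma bdry_update_one (y : Fin n → I) (i : Fin n) :
    Function.update y i 1 ∈ Cube.boundary (Fin n) := ⟨i, by simp⟩

lemma cls_mul (he : e ∈ U) (i : Fin (n + 1)) (f g : C(Fin (n + 1) → I, W)) (hf : IsLoop U e f)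
    (hg : IsLoop U e g) : ∃ (k : C(Fin (n + 1) → I, W)) (hk : IsLoop U e k),
      IsCat i f g k ∧ cls he g hg * cls he f hf = cls he k hk := by
  let p := GenLoop.transAt i (mkL he f hf) (mkL he g hg)
  have hp : ∀ y, p y = if (y i : ℝ) ≤ 1 / 2
      then mkL he f hf (Function.update y i <| Set.projIcc 0 1 zero_le_one (2 * (y i : ℝ)))
      else mkL he g hg (Function.update y i <| Set.projIcc 0 1 zero_le_one (2 * (y i : ℝ) - 1)) :=
    fun y => rfl
  refine ⟨⟨fun y => (p y : W), by fun_prop⟩, ⟨fun y => (p y).2, fun y hy => ?_⟩, ?_, ?_⟩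
  · exact congrArg Subtype.val (p.2 y hy)
  · intro y
    simp only [ContinuousMap.coe_mk, hp]
    refine ⟨fun h => ?_, fun h => ?_⟩
    · rw [if_pos (show (y i : ℝ) ≤ 1 / 2 from h)]; rfl
    · split_ifs with h'
      · have : y i = half := le_antisymm h' h
        rw [this]
        change f (Function.update y i (d0 half)) = g (Function.update y i (d1 half))
        rw [d0_half, d1_half, hf.2 _ (bdry_update_one y i), hg.2 _ (bdry_update_zero y i)]
      · rfl
  · exact HomotopyGroup.mul_spec (i := i)

lemma cls_mul' (he : e ∈ U) (i : Fin (n + 1)) (f g k : C(Fin (n + 1) → I, W)) (hf : IsLoop U e f)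
    (hg : IsLoop U e g) (hk : IsLoop U e k) (h : IsCat i f g k) :
    cls he g hg * cls he f hf = cls he k hk := by
  obtain ⟨k', hk', h', e'⟩ := cls_mul he i f g hf hg
  rw [e']
  congr 1
  ext y
  rcases le_total (y i) half with hy | hy
  · rw [(h y).1 hy, (h' y).1 hy]
  · rw [(h y).2 hy, (h' y).2 hy]

end loops

lemma cons_bdry {n : ℕ} {s : I} {x : Fin n → I} :
    (Fin.cons s x : Fin (n + 1) → I) ∈ Cube.boundary (Fin (n + 1)) ↔
      s = 0 ∨ s = 1 ∨ x ∈ Cube.boundary (Fin n) := by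
  constructor
  · rintro ⟨i, hi⟩
    induction i using Fin.cases with
    | zero => simp at hi; tauto
    | succ j => simp only [Fin.cons_succ] at hi; exact Or.inr (Or.inr ⟨j, hi⟩)
  · rintro (h | h | ⟨j, hj⟩)
    · exact ⟨0, by simp [h]⟩
    · exact ⟨0, by simp [h]⟩
    · exact ⟨j.succ, by simpa using hj⟩

lemma isClosed_bdry (n : ℕ) : IsClosed (Cube.boundary (Fin n)) := by
  have : Cube.boundary (Fin n) = ⋃ i : Fin n, {y | y i = 0 ∨ y i = 1} := by
    ext y; simp [Cube.boundary]
  rw [this]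
  apply isClosed_iUnion_of_finite
  intro i
  exact (isClosed_eq (continuous_apply i) continuous_const).union
    (isClosed_eq (continuous_apply i) continuous_const)

/-- Splitting off the first coordinate. -/
def ucons {W : Type} [TopologicalSpace W] {n : ℕ} (F : C(I × (Fin n → I), W)) :
    C(Fin (n + 1) → I, W) :=
  ⟨fun y => F (y 0, Fin.tail y), F.continuous.comp
    ((continuous_apply 0).prodMk (continuous_pi fun i => continuous_apply i.succ))⟩

@[simp] lemma ucons_cons {W : Type} [TopologicalSpace W] {n : ℕ} (F : C(I × (Fin n → I), W))
    (s : I) (x : Fin n → I) : ucons F (Fin.cons s x) = F (s, x) := by simp [ucons]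

/-- Joining the first coordinate. -/
def ccons {W : Type} [TopologicalSpace W] {n : ℕ} (f : C(Fin (n + 1) → I, W)) :
    C(I × (Fin n → I), W) :=
  ⟨fun p => f (Fin.cons p.1 p.2), f.continuous.comp
    (Continuous.finCons continuous_fst continuous_snd)⟩

lemma ccons_apply {W : Type} [TopologicalSpace W] {n : ℕ} (f : C(Fin (n + 1) → I, W)) (s : I)
    (x : Fin n → I) : ccons f (s, x) = f (Fin.cons s x) := rfl

lemma cons_cases {n : ℕ} {P : (Fin (n + 1) → I) → Prop} (h : ∀ s x, P (Fin.cons s x)) (y) : P y := by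
  rw [← Fin.cons_self_tail y]; exact h _ _

lemma isLoop_ucons {W : Type} [TopologicalSpace W] {n : ℕ} {U : Set W} {e : W}
    (F : C(I × (Fin n → I), W)) (h0 : ∀ p, F p ∈ U) (h1 : ∀ x, F (0, x) = e)
    (h2 : ∀ x, F (1, x) = e) (h3 : ∀ s, ∀ x ∈ Cube.boundary (Fin n), F (s, x) = e) :
    IsLoop U e (ucons F) := by
  refine ⟨fun y => h0 _, cons_cases fun s x h => ?_⟩
  rw [cons_bdry] at h
  rw [ucons_cons]
  rcases h with rfl | rfl | h
  · exact h1 x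
  · exact h2 x
  · exact h3 s x h

end HopfPf

namespace HopfPf
open scoped unitInterval Quaternion Topology.Homotopy

/-! ## Part 3: a Freudenthal type isomorphism -/

/-- Nonzero quaternions. -/
def XX : Set HH := {q | q ≠ 0}
/-- Non-real quaternions. -/
def YY : Set HH := {q | q.im ≠ 0}

lemma im_ne_of_re {e : HH} (h0 : e ≠ 0) (h : e.re = 0) : e ∈ YY := by
  intro hi
  apply h0
  rw [← Quaternion.re_add_im e, hi, h]; simp

lemma YY_Up {q : HH} (h : q ∈ YY) : q ∈ Up := Or.inl h
lemma YY_Um {q : HH} (h : q ∈ YY) : q ∈ Um := Or.inl h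
lemma YY_XX {q : HH} (h : q ∈ YY) : q ∈ XX := mem_Up_ne (YY_Up h)

/-- A map adapted to the suspension structure with given middle section. -/
def Good (F : C(I × (Fin 2 → I), HH)) (g : C(Fin 2 → I, HH)) : Prop :=
  (∀ p, p.1 ≤ half → F p ∈ Up) ∧ (∀ p, half ≤ p.1 → F p ∈ Um) ∧ ∀ x, F (half, x) = g x

lemma Good.ne {F g} (h : Good F g) (p) : F p ∈ XX := by
  rcases le_total p.1 half with h' | h'
  · exact mem_Up_ne (h.1 p h')
  · exact mem_Um_ne (h.2.1 p h')

lemma half_ne_zero : half ≠ 0 := fun h => by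
  have := congrArg Subtype.val h
  norm_num [half] at this
lemma half_ne_one : half ≠ 1 := fun h => by
  have := congrArg Subtype.val h
  norm_num [half] at this

/-- The side condition for a suspension. -/
def Side (s : I) (x : Fin 2 → I) : Prop := s = 0 ∨ s = 1 ∨ x ∈ Cube.boundary (Fin 2)

lemma loop_side {F : C(I × (Fin 2 → I), HH)} {U e} (h : IsLoop U e (ucons F)) {s x}
    (hs : Side s x) : F (s, x) = e := by
  rw [← ucons_cons]; exact h.2 _ (cons_bdry.2 hs)

lemma side_half {x} (h : Side half x) : x ∈ Cube.boundary (Fin 2) := by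
  rcases h with h | h | h
  · exact absurd h half_ne_zero
  · exact absurd h half_ne_one
  · exact h

lemma isClosed_side : IsClosed {p : I × (Fin 2 → I) | Side p.1 p.2} :=
  (isClosed_eq continuous_fst continuous_const).union
    ((isClosed_eq continuous_fst continuous_const).union
      ((isClosed_bdry 2).preimage continuous_snd))

lemma isLoop_of_side {F : C(I × (Fin 2 → I), HH)} {U e} (h0 : ∀ p, F p ∈ U)
    (h : ∀ s x, Side s x → F (s, x) = e) : IsLoop U e (ucons F) :=
  isLoop_ucons F h0 (fun _ => h _ _ (Or.inl rfl)) (fun _ => h _ _ (Or.inr (Or.inl rfl)))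
    (fun _ _ hx => h _ _ (Or.inr (Or.inr hx)))

/-- Build a homotopy of suspended loops. -/
lemma isHtpy_of_side {F F' : C(I × (Fin 2 → I), HH)} {U : Set HH} {e : HH}
    (K : C(I × (I × (Fin 2 → I)), HH)) (h0 : ∀ s x, K (s, (0, x)) = F (s, x))
    (h1 : ∀ s x, K (s, (1, x)) = F' (s, x)) (h2 : ∀ p, K p ∈ U)
    (h3 : ∀ s t x, Side s x → K (s, (t, x)) = e) : IsHtpy U e (ucons F) (ucons F') := by
  refine ⟨⟨fun p => K (p.2 0, (p.1, Fin.tail p.2)), K.continuous.comp ?_⟩, fun y => h0 _ _,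
    fun y => h1 _ _, fun p => h2 _, fun t => cons_cases fun s x hx => ?_⟩
  · have : Continuous fun p : I × (Fin 3 → I) => (Fin.tail p.2 : Fin 2 → I) :=
      continuous_pi fun i => (continuous_apply i.succ).comp continuous_snd
    fun_prop
  · simp only [ContinuousMap.coe_mk, Fin.cons_zero, Fin.tail_cons]
    exact h3 s t x (cons_bdry.1 hx)

lemma good_exists {e : HH} (he : e ∈ YY) (g : C(Fin 2 → I, HH)) (hg : IsLoop YY e g) :
    ∃ F, Good F g ∧ IsLoop XX e (ucons F) := by
  classical
  let φ : I × (Fin 2 → I) → HH := fun p => if p.1 = half then g p.2 else e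
  have c1 : IsClosed {p : I × (Fin 2 → I) | p.1 = half} := isClosed_eq continuous_fst continuous_const
  have a1 : ∀ p ∈ {p : I × (Fin 2 → I) | p.1 = half}, φ p = g p.2 := fun p hp => if_pos hp
  have a2 : ∀ p ∈ {p : I × (Fin 2 → I) | Side p.1 p.2}, φ p = e := by
    rintro ⟨s, x⟩ hp
    by_cases h : s = half
    · subst h
      rw [a1 _ rfl]
      exact hg.2 _ (side_half hp)
    · exact if_neg h
  have hY : ∀ p ∈ {p : I × (Fin 2 → I) | p.1 = half} ∪ {p | Side p.1 p.2}, φ p ∈ YY := by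
    rintro p (hp | hp)
    · rw [a1 p hp]; exact hg.1 _
    · rw [a2 p hp]; exact he
  obtain ⟨F, b1, b2, b3⟩ := susp_ext (c1.union isClosed_side) (fun t => Or.inl rfl) φ
    (ContinuousOn.union_of_isClosed
      ((show Continuous fun p : I × (Fin 2 → I) => g p.2 by fun_prop).continuousOn.congr a1)
      (continuousOn_const.congr a2) c1 isClosed_side)
    (fun p hp _ => YY_Up (hY p hp)) (fun p hp _ => YY_Um (hY p hp))
  have hG : Good F g := ⟨b2, b3, fun x => by rw [b1 _ (Or.inl rfl), a1 _ rfl]⟩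
  exact ⟨F, hG, isLoop_of_side hG.ne fun s x h => by rw [b1 _ (Or.inr h), a2 _ h]⟩

lemma good_htpy {e : HH} (he : e ∈ YY) {g g' : C(Fin 2 → I, HH)} {F F'}
    (hF : Good F g) (hF' : Good F' g') (lF : IsLoop XX e (ucons F)) (lF' : IsLoop XX e (ucons F'))
    (h : IsHtpy YY e g g') : IsHtpy XX e (ucons F) (ucons F') := by
  classical
  obtain ⟨G, g0, g1, g2, g3⟩ := h
  let φ : I × (I × (Fin 2 → I)) → HH := fun p => if p.2.1 = 0 then F (p.1, p.2.2) else
    if p.2.1 = 1 then F' (p.1, p.2.2) else if p.1 = half then G p.2 else e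
  let A1 : Set (I × (I × (Fin 2 → I))) := {p | p.2.1 = 0}
  let A2 : Set (I × (I × (Fin 2 → I))) := {p | p.2.1 = 1}
  let A3 : Set (I × (I × (Fin 2 → I))) := {p | p.1 = half}
  let A4 : Set (I × (I × (Fin 2 → I))) := {p | Side p.1 p.2.2}
  have c1 : IsClosed A1 := isClosed_eq (by fun_prop) continuous_const
  have c2 : IsClosed A2 := isClosed_eq (by fun_prop) continuous_const
  have c3 : IsClosed A3 := isClosed_eq (by fun_prop) continuous_const
  have c4 : IsClosed A4 := isClosed_side.preimage
    (show Continuous fun p : I × (I × (Fin 2 → I)) => (p.1, p.2.2) by fun_prop)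
  have a1 : ∀ p ∈ A1, φ p = F (p.1, p.2.2) := fun p hp => if_pos hp
  have a2 : ∀ p ∈ A2, φ p = F' (p.1, p.2.2) := by
    intro p hp
    have hp' : p.2.1 = 1 := hp
    simp [φ, hp']
  have a3 : ∀ p ∈ A3, φ p = G p.2 := by
    rintro ⟨s, t, x⟩ hp
    have hp' : s = half := hp
    subst hp'
    simp only [φ]
    split_ifs with h1 h2
    · rw [h1, hF.2.2, g0]
    · rw [h2, hF'.2.2, g1]
    · rfl
  have a4 : ∀ p ∈ A4, φ p = e := by
    rintro ⟨s, t, x⟩ hp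
    simp only [φ]
    split_ifs with h1 h2 h3
    · exact loop_side lF hp
    · exact loop_side lF' hp
    · subst h3
      exact g3 _ _ (side_half hp)
    · rfl
  obtain ⟨K, b1, b2, b3⟩ := susp_ext (((c1.union c2).union c3).union c4)
    (fun t => Or.inl (Or.inr rfl)) φ
    (((((show Continuous fun p : I × (I × (Fin 2 → I)) => F (p.1, p.2.2)
        by fun_prop).continuousOn.congr a1).union_of_isClosed
      ((show Continuous fun p : I × (I × (Fin 2 → I)) => F' (p.1, p.2.2)
        by fun_prop).continuousOn.congr a2) c1 c2).union_of_isClosed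
      ((show Continuous fun p : I × (I × (Fin 2 → I)) => G p.2
        by fun_prop).continuousOn.congr a3) (c1.union c2) c3).union_of_isClosed
      (continuousOn_const.congr a4) ((c1.union c2).union c3) c4)
    (by
      rintro p (((hp | hp) | hp) | hp) hs
      · rw [a1 p hp]; exact hF.1 _ hs
      · rw [a2 p hp]; exact hF'.1 _ hs
      · rw [a3 p hp]; exact YY_Up (g2 _)
      · rw [a4 p hp]; exact YY_Up he)
    (by
      rintro p (((hp | hp) | hp) | hp) hs
      · rw [a1 p hp]; exact hF.2.1 _ hs
      · rw [a2 p hp]; exact hF'.2.1 _ hs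
      · rw [a3 p hp]; exact YY_Um (g2 _)
      · rw [a4 p hp]; exact YY_Um he)
  refine isHtpy_of_side K (fun s x => ?_) (fun s x => ?_) (fun p => ?_) (fun s t x h => ?_)
  · have hm : ((s, (0, x)) : I × (I × (Fin 2 → I))) ∈ A1 := rfl
    rw [b1 _ (Or.inl (Or.inl (Or.inl hm))), a1 _ hm]
  · have hm : ((s, (1, x)) : I × (I × (Fin 2 → I))) ∈ A2 := rfl
    rw [b1 _ (Or.inl (Or.inl (Or.inr hm))), a2 _ hm]
  · rcases le_total p.1 half with h' | h'
    · exact mem_Up_ne (b2 p h')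
    · exact mem_Um_ne (b3 p h')
  · have hm : ((s, (t, x)) : I × (I × (Fin 2 → I))) ∈ A4 := h
    rw [b1 _ (Or.inr hm), a4 _ hm]

lemma good_cat {g g' k : C(Fin 2 → I, HH)} {F F' : C(I × (Fin 2 → I), HH)} {K : C(Fin 3 → I, HH)}
    (hF : Good F g) (hF' : Good F' g')
    (hk : IsCat 0 g g' k) (hK : IsCat 1 (ucons F) (ucons F') K) : Good (ccons K) k := by
  have key : ∀ s x, (x 0 ≤ half → ccons K (s, x) = F (s, Function.update x 0 (d0 (x 0)))) ∧
      (half ≤ x 0 → ccons K (s, x) = F' (s, Function.update x 0 (d1 (x 0)))) := by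
    intro s x
    have hu : ∀ v, Function.update (Fin.cons s x : Fin 3 → I) 1 v =
        Fin.cons s (Function.update x 0 v) := fun v =>
      (Fin.cons_update (α := fun _ => I) s x 0 v).symm
    have h := hK (Fin.cons s x)
    rw [hu, hu, ucons_cons, ucons_cons] at h
    exact h
  refine ⟨fun ⟨s, x⟩ hs => ?_, fun ⟨s, x⟩ hs => ?_, fun x => ?_⟩
  · rcases le_total (x 0) half with h | h
    · rw [(key s x).1 h]; exact hF.1 _ hs
    · rw [(key s x).2 h]; exact hF'.1 _ hs
  · rcases le_total (x 0) half with h | h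
    · rw [(key s x).1 h]; exact hF.2.1 _ hs
    · rw [(key s x).2 h]; exact hF'.2.1 _ hs
  · rcases le_total (x 0) half with h | h
    · rw [(key _ x).1 h, (hk x).1 h, hF.2.2]
    · rw [(key _ x).2 h, (hk x).2 h, hF'.2.2]

lemma ucons_ccons {n : ℕ} (K : C(Fin (n + 1) → I, HH)) : ucons (ccons K) = K := by
  ext1 y
  change K (Fin.cons (y 0) (Fin.tail y)) = K y
  rw [Fin.cons_self_tail]

/-- Reparametrisation. -/
def rho (v s : ℝ) : ℝ := 2 * v * min s (1 / 2) + (1 - v) * max (2 * s - 1) 0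

/-- Projection onto the unit interval. -/
def pI (x : ℝ) : I := projIcc 0 1 zero_le_one x
lemma continuous_pI : Continuous pI := continuous_projIcc (h := zero_le_one)
@[simp] lemma pI_coe (s : I) : pI s = s := projIcc_val _ s
lemma pI_mono {x y : ℝ} (h : x ≤ y) : pI x ≤ pI y := monotone_projIcc _ h
@[simp] lemma pI_zero : pI 0 = 0 := projIcc_left _
@[simp] lemma pI_one : pI 1 = 1 := projIcc_right _

lemma line_ne {a b : HH} (h : ‖b - a‖ < ‖a‖) (t : I) : a + (t : ℝ) • (b - a) ≠ 0 := by
  intro h0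
  have h1 : ‖(t : ℝ) • (b - a)‖ ≤ ‖b - a‖ := by
    rw [norm_smul, Real.norm_of_nonneg t.2.1]
    exact mul_le_of_le_one_left (norm_nonneg _) t.2.2
  have : ‖a‖ = ‖(t : ℝ) • (b - a)‖ := by
    rw [← norm_neg a, neg_eq_of_add_eq_zero_right h0]
  linarith

lemma closedEmb_cube (n : ℕ) :
    Topology.IsClosedEmbedding (fun x : Fin n → I => fun i => (x i : ℝ)) :=
  Continuous.isClosedEmbedding (by fun_prop) fun x y h => by
    ext i; exact congrFun h i

lemma split_of_or {T : Type} {F : I × T → HH} {t : T} (h0 : F (0, t) ∈ YY) (h1 : F (1, t) ∈ YY)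
    (h : (∀ s, F (s, t) ∈ Up) ∨ (∀ s, F (s, t) ∈ Um)) :
    ∃ v : I, (∀ s ≤ v, F (s, t) ∈ Up) ∧ (∀ s, v ≤ s → F (s, t) ∈ Um) := by
  rcases h with h | h
  · refine ⟨1, fun s _ => h s, fun s hs => ?_⟩
    rw [le_antisymm (show s ≤ 1 from s.2.2) hs]; exact YY_Um h1
  · refine ⟨0, fun s hs => ?_, fun s _ => h s⟩
    rw [le_antisymm hs (show 0 ≤ s from s.2.1)]; exact YY_Up h0

lemma susp_surj {e : HH} (he : e ∈ YY) (hre : e.re = 0) (f : C(Fin 3 → I, HH))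
    (hf : IsLoop XX e f) : ∃ g F, IsLoop YY e g ∧ Good F g ∧ IsLoop XX e (ucons F) ∧
      IsHtpy XX e f (ucons F) := by
  have hfe : ucons (ccons f) = f := ucons_ccons f
  obtain ⟨F1, -, b2, b3, -, b5⟩ := gp (by simp) (closedEmb_cube 2) (ccons f) (fun d => hf.1 _)
    one_pos (ContinuousMap.const _ 1)
  have sd : ∀ s x, Side s x → F1 (s, x) = e := by
    intro s x h
    have : ccons f (s, x) = e := loop_side (by rw [hfe]; exact hf) h
    rw [b3 _ (by rw [this, hre]), this]
  have ne1 : ∀ p, F1 p ∈ XX := by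
    intro p h0
    have := b2 p
    rw [h0, zero_sub, norm_neg] at this
    exact lt_irrefl _ this
  have l1 : IsLoop XX e (ucons F1) := isLoop_of_side ne1 sd
  have H1 : IsHtpy XX e (ucons (ccons f)) (ucons F1) := by
    refine isHtpy_of_side ⟨fun p => ccons f (p.1, p.2.2) +
      (p.2.1 : ℝ) • (F1 (p.1, p.2.2) - ccons f (p.1, p.2.2)), by fun_prop⟩ ?_ ?_ ?_ ?_
    · intro s x; simp
    · intro s x; simp
    · intro p; exact line_ne (b2 _) _
    · intro s t x h
      simp only [ContinuousMap.coe_mk]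
      rw [sd s x h, loop_side (by rw [hfe]; exact hf) h]; simp
  obtain ⟨τ, hτ⟩ := select F1 (fun x => split_of_or
    (by rw [sd _ _ (Or.inl rfl)]; exact he) (by rw [sd _ _ (Or.inr (Or.inl rfl))]; exact he)
    (b5 x rfl))
  have crho : Continuous fun p : ℝ × ℝ => rho p.1 p.2 := by unfold rho; fun_prop
  have cp := continuous_pI
  let F2 : C(I × (Fin 2 → I), HH) := ⟨fun p => F1 (pI (rho (τ p.2) p.1), p.2), by
    have : Continuous fun p : I × (Fin 2 → I) => rho (τ p.2) p.1 :=
      crho.comp (show Continuous fun p : I × (Fin 2 → I) => ((τ p.2 : ℝ), (p.1 : ℝ)) by fun_prop)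
    fun_prop⟩
  let g : C(Fin 2 → I, HH) := ⟨fun x => F1 (τ x, x), by fun_prop⟩
  have r0 : ∀ v, rho v 0 = 0 := by intro v; simp [rho]
  have r1 : ∀ v, rho v 1 = 1 := by
    intro v
    have : min (1 : ℝ) (1 / 2) = 1 / 2 := by norm_num
    simp only [rho, this]; norm_num; ring
  have rl : ∀ v s : I, s ≤ half → rho v s ≤ v := by
    intro v s h
    have h' : (s : ℝ) ≤ 1 / 2 := h
    simp only [rho]
    rw [max_eq_right (by linarith), min_eq_left h']
    nlinarith [v.2.1]
  have rr : ∀ v s : I, half ≤ s → (v : ℝ) ≤ rho v s := by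
    intro v s h
    have h' : 1 / 2 ≤ (s : ℝ) := h
    simp only [rho]
    rw [max_eq_left (by linarith), min_eq_right h']
    nlinarith [v.2.2]
  have rsd : ∀ s x, Side s x → F2 (s, x) = e := by
    rintro s x (rfl | rfl | h)
    · change F1 (pI (rho (τ x) ((0 : I) : ℝ)), x) = e
      rw [Icc.coe_zero, r0, pI_zero]; exact sd _ _ (Or.inl rfl)
    · change F1 (pI (rho (τ x) ((1 : I) : ℝ)), x) = e
      rw [Icc.coe_one, r1, pI_one]; exact sd _ _ (Or.inr (Or.inl rfl))
    · exact sd _ _ (Or.inr (Or.inr h))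
  have l2 : IsLoop XX e (ucons F2) := isLoop_of_side (fun p => ne1 _) rsd
  have hG : Good F2 g := by
    refine ⟨fun p hp => ?_, fun p hp => ?_, fun x => ?_⟩
    · refine (hτ p.2).1 _ ?_
      simpa using pI_mono (rl (τ p.2) p.1 hp)
    · refine (hτ p.2).2 _ ?_
      simpa using pI_mono (rr (τ p.2) p.1 hp)
    · change F1 (pI (rho (τ x) half), x) = F1 (τ x, x)
      rw [le_antisymm (rl (τ x) half le_rfl) (rr (τ x) half le_rfl), pI_coe]
  have H2 : IsHtpy XX e (ucons F1) (ucons F2) := by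
    refine isHtpy_of_side ⟨fun p => F1 (pI ((1 - (p.2.1 : ℝ)) * p.1 +
      p.2.1 * rho (τ p.2.2) p.1), p.2.2), ?_⟩ ?_ ?_ ?_ ?_
    · have : Continuous fun p : I × (I × (Fin 2 → I)) => rho (τ p.2.2) p.1 :=
        crho.comp (show Continuous fun p : I × (I × (Fin 2 → I)) => ((τ p.2.2 : ℝ), (p.1 : ℝ))
          by fun_prop)
      fun_prop
    · intro s x; simp
    · intro s x; simp [F2]
    · intro p; exact ne1 _
    · rintro s t x (rfl | rfl | h)
      · simp only [ContinuousMap.coe_mk, Icc.coe_zero, r0]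
        simpa using sd _ _ (Or.inl rfl)
      · simp only [ContinuousMap.coe_mk, Icc.coe_one, r1]
        simpa using sd _ _ (Or.inr (Or.inl rfl))
      · exact sd _ _ (Or.inr (Or.inr h))
  have lg : IsLoop YY e g := ⟨fun x => im_ne_of_mem ((hτ x).1 _ le_rfl) ((hτ x).2 _ le_rfl),
    fun x hx => sd _ _ (Or.inr (Or.inr hx))⟩
  rw [hfe] at H1
  exact ⟨g, F2, lg, hG, l2, H1.trans (YY_XX he) hf l1 l2 H2⟩

lemma stab {D : Type} [TopologicalSpace D] [CompactSpace D] (F : C(D, HH)) {A : Set D}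
    (hA : IsClosed A) {U : Set HH} (hU : IsOpen U) (h : ∀ d ∈ A, F d ∈ U) :
    ∃ η > 0, ∀ d ∈ A, ∀ q, ‖q - F d‖ < η → q ∈ U := by
  obtain ⟨δ, hδ, h1⟩ := (hA.isCompact.image F.continuous).exists_thickening_subset_open hU
    (by rintro _ ⟨d, hd, rfl⟩; exact h d hd)
  refine ⟨δ, hδ, fun d hd q hq => h1 ?_⟩
  rw [Metric.mem_thickening_iff]
  exact ⟨F d, ⟨d, hd, rfl⟩, by rwa [dist_eq_norm]⟩

lemma d0_of_ge {t : I} (h : half ≤ t) : d0 t = 1 :=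
  projIcc_of_right_le _ (by have : 1 / 2 ≤ (t : ℝ) := h; linarith)
lemma d1_of_le {t : I} (h : t ≤ half) : d1 t = 0 :=
  projIcc_of_le_left _ (by have : (t : ℝ) ≤ 1 / 2 := h; linarith)

lemma susp_inj {e : HH} (he : e ∈ YY) (hre : e.re = 0) {g : C(Fin 2 → I, HH)}
    {F : C(I × (Fin 2 → I), HH)} (hg : IsLoop YY e g) (hF : Good F g)
    (lF : IsLoop XX e (ucons F))
    (h : IsHtpy XX e (ucons F) (ContinuousMap.const _ e)) :
    IsHtpy YY e g (ContinuousMap.const _ e) := by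
  obtain ⟨H, h0, h1, h2, h3⟩ := h
  obtain ⟨η1, hη1, s1⟩ := stab F (isClosed_le continuous_fst continuous_const) isOpen_Up hF.1
  obtain ⟨η2, hη2, s2⟩ := stab F (isClosed_le continuous_const continuous_fst) isOpen_Um hF.2.1
  have c0 := continuous_d0
  have c1 := continuous_d1
  let Φ : C(I × (I × (Fin 2 → I)), HH) := ⟨fun p => H (d1 p.2.1, Fin.cons p.1 p.2.2), by
    have : Continuous fun p : I × (I × (Fin 2 → I)) => (Fin.cons p.1 p.2.2 : Fin 3 → I) :=
      Continuous.finCons continuous_fst continuous_snd.snd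
    fun_prop⟩
  have emb : Topology.IsClosedEmbedding
      (fun p : I × (Fin 2 → I) => ((p.1 : ℝ), fun i => (p.2 i : ℝ))) :=
    (isClosed_Icc.isClosedEmbedding_subtypeVal).prodMap (closedEmb_cube 2)
  obtain ⟨K, k1, -, k3, k4, k5⟩ := gp (by simp) emb Φ (fun p => h2 _) (lt_min hη1 hη2)
    ⟨fun p => d0 p.1, by fun_prop⟩
  have hΦe : ∀ s t x, Side s x → Φ (s, (t, x)) = e := fun s t x hs => h3 _ _ (cons_bdry.2 hs)
  have hKe : ∀ s t x, Side s x → K (s, (t, x)) = e := fun s t x hs => by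
    rw [k3 _ (by rw [hΦe _ _ _ hs, hre]), hΦe _ _ _ hs]
  have hΦF : ∀ s t x, t ≤ half → Φ (s, (t, x)) = F (s, x) := by
    intro s t x ht
    change H (d1 t, Fin.cons s x) = _
    rw [d1_of_le ht, h0, ucons_cons]
  have hK0 : ∀ s x, K (s, (0, x)) = F (s, x) := by
    intro s x
    rw [k4 _ d0_zero, hΦF _ _ _ half.2.1]
  obtain ⟨τ, hτ⟩ := select K (by
    rintro ⟨t, x⟩
    rcases le_total t half with ht | ht
    · refine ⟨half, fun s hs => s1 (s, x) hs _ ?_, fun s hs => s2 (s, x) hs _ ?_⟩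
      · have := (k1 (s, (t, x))).trans_le (min_le_left _ _)
        rwa [hΦF _ _ _ ht] at this
      · have := (k1 (s, (t, x))).trans_le (min_le_right _ _)
        rwa [hΦF _ _ _ ht] at this
    · exact split_of_or (by rw [hKe _ _ _ (Or.inl rfl)]; exact he)
        (by rw [hKe _ _ _ (Or.inr (Or.inl rfl))]; exact he) (k5 _ (d0_of_ge ht)))
  have cp := continuous_pI
  let g' : C(Fin 2 → I, HH) := ⟨fun x => F (τ (0, x), x), by fun_prop⟩
  have hτ0 : ∀ x, (∀ s ≤ τ (0, x), F (s, x) ∈ Up) ∧ (∀ s, τ (0, x) ≤ s → F (s, x) ∈ Um) := by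
    intro x
    have := hτ (0, x)
    simp only [hK0] at this
    exact this
  have lg' : IsLoop YY e g' := ⟨fun x => im_ne_of_mem ((hτ0 x).1 _ le_rfl) ((hτ0 x).2 _ le_rfl),
    fun x hx => loop_side lF (Or.inr (Or.inr hx))⟩
  have H1 : IsHtpy YY e g g' := by
    refine ⟨⟨fun p => F (pI ((1 - (p.1 : ℝ)) * half + p.1 * τ (0, p.2)), p.2), by fun_prop⟩,
      fun y => ?_, fun y => ?_, ?_, fun t y hy => loop_side lF (Or.inr (Or.inr hy))⟩
    · simp [hF.2.2]
    · simp [g']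
    · rintro ⟨t, x⟩
      simp only [ContinuousMap.coe_mk]
      have ht0 := t.2.1
      have ht1 := t.2.2
      rcases le_total (τ (0, x)) half with hh | hh
      · have hh' : (τ (0, x) : ℝ) ≤ half := hh
        apply im_ne_of_mem
        · apply hF.1
          change pI _ ≤ half
          rw [← pI_coe half]
          apply pI_mono; simp only [pI_coe]; nlinarith
        · apply (hτ0 x).2
          rw [← pI_coe (τ (0, x))]
          apply pI_mono; simp only [pI_coe]; nlinarith
      · have hh' : (half : ℝ) ≤ τ (0, x) := hh
        apply im_ne_of_mem
        · apply (hτ0 x).1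
          rw [← pI_coe (τ (0, x))]
          apply pI_mono; simp only [pI_coe]; nlinarith
        · apply hF.2.1
          change half ≤ pI _
          rw [← pI_coe half]
          apply pI_mono; simp only [pI_coe]; nlinarith
  have H2 : IsHtpy YY e g' (ContinuousMap.const _ e) := by
    refine ⟨⟨fun p => K (τ p, p), by fun_prop⟩, fun y => hK0 _ _, fun y => ?_,
      fun p => im_ne_of_mem ((hτ p).1 _ le_rfl) ((hτ p).2 _ le_rfl),
      fun t y hy => hKe _ _ _ (Or.inr (Or.inr hy))⟩
    have : ∀ s, Φ (s, (1, y)) = e := by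
      intro s
      change H (d1 1, _) = e
      rw [d1_one, h1]; rfl
    change K _ = e
    rw [k3 _ (by rw [this, hre]), this]
  exact H1.trans he hg lg' (isLoop_const he) H2

theorem susp_iso {e : HH} (he : e ∈ YY) (hre : e.re = 0) (he' : e ∈ XX) :
    Nonempty (π_ 2 YY (⟨e, he⟩ : YY) ≃* π_ 3 XX (⟨e, he'⟩ : XX)) := by
  apply rel_mulEquiv (fun a b => ∃ g F, ∃ (hg : IsLoop YY e g) (hF : IsLoop XX e (ucons F)),
    Good F g ∧ a = cls he g hg ∧ b = cls he' (ucons F) hF)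
  · intro a
    obtain ⟨g, hg, rfl⟩ := exists_cls he a
    obtain ⟨F, h1, h2⟩ := good_exists he g hg
    exact ⟨_, g, F, hg, h2, h1, rfl, rfl⟩
  · rintro a b b' ⟨g, F, hg, hF, h1, rfl, rfl⟩ ⟨g', F', hg', hF', h1', h2, rfl⟩
    rw [cls_eq]
    exact good_htpy he h1 h1' hF hF' (cls_eq.1 h2)
  · rintro a a' b b' ⟨g, F, hg, hF, h1, rfl, rfl⟩ ⟨g', F', hg', hF', h1', rfl, rfl⟩
    obtain ⟨k, hk, c1, e1⟩ := cls_mul he 0 g' g hg' hg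
    obtain ⟨K, hK, c2, e2⟩ := cls_mul he' 1 (ucons F') (ucons F) hF' hF
    refine ⟨k, ccons K, hk, by rw [ucons_ccons]; exact hK, good_cat h1' h1 c1 c2, e1, ?_⟩
    rw [e2]
    congr 1
    exact (ucons_ccons K).symm
  · intro b
    obtain ⟨f, hf, rfl⟩ := exists_cls he' b
    obtain ⟨g, F, hg, h1, h2, h3⟩ := susp_surj he hre f hf
    exact ⟨_, g, F, hg, h2, h1, rfl, cls_eq.2 h3⟩
  · rintro a ⟨g, F, hg, hF, h1, rfl, h2⟩
    rw [← cls_const he', eq_comm, cls_eq] at h2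
    rw [← cls_const he, cls_eq]
    exact susp_inj he hre hg h1 hF h2

end HopfPf

namespace HopfPf
open scoped unitInterval Quaternion Topology.Homotopy

/-! ## Part 4: the Hopf fibration and logarithms -/

/-- The unit `i`. -/
def ii : HH := ⟨0, 1, 0, 0⟩
@[simp] lemma ii_re : ii.re = 0 := rfl
@[simp] lemma ii_imI : ii.imI = 1 := rfl
@[simp] lemma ii_imJ : ii.imJ = 0 := rfl
@[simp] lemma ii_imK : ii.imK = 0 := rfl
lemma ii_sq : ii * ii = -1 := by ext <;> simp
lemma ii_ne : ii ≠ 0 := fun h => by simpa [ii] using congrArg (fun q : HH => q.imI) h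

/-- Unit imaginary quaternions. -/
def SS : Set HH := {q | q * q = -1}

lemma SS_norm {q : HH} (h : q ∈ SS) : ‖q‖ = 1 := by
  have h1 : ‖q * q‖ = 1 := by rw [show q * q = -1 from h]; simp
  rw [norm_mul] at h1
  nlinarith [norm_nonneg q]

lemma SS_ne {q : HH} (h : q ∈ SS) : q ≠ 0 := by
  intro h0; have := SS_norm h; rw [h0] at this; simp at this

lemma SS_re {q : HH} (h : q ∈ SS) : q.re = 0 := by
  have h1 : q * q = -1 := h
  have e0 := congrArg (fun q : HH => q.re) h1
  have e1 := congrArg (fun q : HH => q.imI) h1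
  have e2 := congrArg (fun q : HH => q.imJ) h1
  have e3 := congrArg (fun q : HH => q.imK) h1
  simp only [Quaternion.re_mul, Quaternion.imI_mul, Quaternion.imJ_mul, Quaternion.imK_mul,
    Quaternion.re_neg, Quaternion.imI_neg, Quaternion.imJ_neg, Quaternion.imK_neg,
    Quaternion.re_one, Quaternion.imI_one, Quaternion.imJ_one, Quaternion.imK_one] at e0 e1 e2 e3
  by_contra hr
  have f1 : q.imI = 0 := by
    apply (mul_eq_zero.1 (show q.re * q.imI = 0 by linarith)).resolve_left hr
  have f2 : q.imJ = 0 := by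
    apply (mul_eq_zero.1 (show q.re * q.imJ = 0 by linarith)).resolve_left hr
  have f3 : q.imK = 0 := by
    apply (mul_eq_zero.1 (show q.re * q.imK = 0 by linarith)).resolve_left hr
  rw [f1, f2, f3] at e0
  nlinarith [mul_self_nonneg q.re]

lemma SS_of {q : HH} (h : q.re = 0) (hn : ‖q‖ = 1) : q ∈ SS := by
  have h1 : star q = -q := by ext <;> simp [h]
  have h2 := Quaternion.self_mul_star q
  rw [Quaternion.normSq_eq_norm_mul_self, hn, h1] at h2
  change q * q = -1
  rw [mul_neg] at h2
  rw [← neg_neg (q * q), h2]; simp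

/-- Transport between two points. -/
def tr (b b' : HH) : HH := (1 / 2 : ℝ) • (1 - b' * b)
lemma tr_self {b : HH} (h : b ∈ SS) : tr b b = 1 := by
  rw [tr, show b * b = -1 from h, sub_neg_eq_add, smul_add, ← add_smul]; norm_num
lemma tr_mul {b b' : HH} (h : b ∈ SS) (h' : b' ∈ SS) : tr b b' * b = b' * tr b b' := by
  have e1 : b * b = -1 := h
  have e2 : b' * b' = -1 := h'
  rw [tr, smul_mul_assoc, mul_smul_comm, sub_mul, mul_sub, mul_assoc, e1, ← mul_assoc, e2]
  simp [add_comm]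
lemma tr_ne {b b' : HH} (h : b ∈ SS) (hd : ‖b - b'‖ < 2) : tr b b' ≠ 0 := by
  intro h0
  have e1 : b * b = -1 := h
  have h1 : 1 - b' * b = 0 := (smul_eq_zero.1 h0).resolve_left (by norm_num)
  have h2 : b = b' * b * b := by rw [← sub_eq_zero.1 h1, one_mul]
  rw [mul_assoc, e1, mul_neg, mul_one] at h2
  have : b - b' = (2 : ℝ) • b := by rw [two_smul]; nth_rw 3 [h2]; abel
  rw [this, norm_smul, SS_norm h] at hd
  norm_num at hd

/-- Path lifting for the Hopf fibration. -/
lemma hopf_lift {Z : Type} [PseudoMetricSpace Z] [CompactSpace Z] (f : C(I × Z, HH))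
    (hf : ∀ p, f p ∈ SS) (F0 : C(Z, HH)) (h0 : ∀ z, F0 z ≠ 0)
    (h1 : ∀ z, F0 z * ii = f (0, z) * F0 z) :
    ∃ F : C(I × Z, HH), (∀ p, F p ≠ 0) ∧ (∀ p, F p * ii = f p * F p) ∧
      (∀ z, F (0, z) = F0 z) ∧ ∀ z, (∀ s, f (s, z) = f (0, z)) → ∀ s, F (s, z) = F0 z := by
  have huc := CompactSpace.uniformContinuous_of_continuous f.continuous
  rw [Metric.uniformContinuous_iff] at huc
  obtain ⟨δ, hδ, hd⟩ := huc 2 two_pos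
  obtain ⟨N, hN⟩ := exists_nat_one_div_lt hδ
  let c : ℕ → I := fun k => pI ((k : ℝ) / (N + 1))
  have hN0 : (0 : ℝ) < N + 1 := by positivity
  have hdist : ∀ k s, dist (min s (c k)) (min s (c (k + 1))) < δ := by
    intro k s
    have m1 : c k ≤ c (k + 1) := pI_mono (by push_cast; gcongr; linarith)
    have m2 : (c (k + 1) : ℝ) ≤ c k + 1 / (N + 1) := by
      have e1 : ((k + 1 : ℕ) : ℝ) / (N + 1) = (k : ℝ) / (N + 1) + 1 / (N + 1) := by
        push_cast; ring
      simp only [c, e1, pI, coe_projIcc]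
      have hp : (0 : ℝ) < 1 / (N + 1) := by positivity
      have hk : (0 : ℝ) ≤ (k : ℝ) / (N + 1) := by positivity
      rw [max_eq_right (le_min zero_le_one (by positivity)),
        max_eq_right (le_min zero_le_one (by positivity))]
      rcases le_total 1 ((k : ℝ) / (N + 1)) with h | h
      · rw [min_eq_left h]; exact (min_le_left _ _).trans (by linarith)
      · rw [min_eq_right h]; exact min_le_right _ _
    have m3 : ((min s (c (k + 1)) : I) : ℝ) ≤ (min s (c k) : I) + 1 / (N + 1) := by
      rcases le_total s (c k) with h | h
      · rw [min_eq_left h, min_eq_left (h.trans m1)]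
        have : (0 : ℝ) < 1 / (N + 1) := by positivity
        linarith
      · rw [min_eq_right h]
        exact le_trans (show ((min s (c (k + 1)) : I) : ℝ) ≤ c (k + 1) from min_le_right s _) m2
    have m4 : ((min s (c k) : I) : ℝ) ≤ (min s (c (k + 1)) : I) := min_le_min_left s m1
    rw [Subtype.dist_eq, Real.dist_eq, abs_lt]
    constructor <;> linarith
  have hmain : ∀ k : ℕ, ∃ F : C(I × Z, HH), (∀ p, F p ≠ 0) ∧
      (∀ p, F p * ii = f (min p.1 (c k), p.2) * F p) ∧
      (∀ z, F (0, z) = F0 z) ∧ ∀ z, (∀ s, f (s, z) = f (0, z)) → ∀ s, F (s, z) = F0 z := by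
    intro k
    induction k with
    | zero =>
      refine ⟨⟨fun p => F0 p.2, by fun_prop⟩, fun p => h0 _, fun p => ?_, fun z => rfl,
        fun z _ s => rfl⟩
      have : min p.1 (c 0) = 0 := by
        simp only [c, Nat.cast_zero, zero_div, pI_zero]; exact min_eq_right p.1.2.1
      rw [this]; exact h1 _
    | succ k ih =>
      obtain ⟨F, a1, a2, a3, a4⟩ := ih
      refine ⟨⟨fun p => tr (f (min p.1 (c k), p.2)) (f (min p.1 (c (k + 1)), p.2)) * F p, by
        unfold tr; fun_prop⟩, fun p => mul_ne_zero (tr_ne (hf _) ?_) (a1 p), fun p => ?_,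
        fun z => ?_, fun z hz s => ?_⟩
      · rw [← dist_eq_norm]
        apply hd
        rw [Prod.dist_eq]
        simpa [hδ] using hdist k p.1
      · simp only [ContinuousMap.coe_mk]
        rw [mul_assoc, a2, ← mul_assoc, tr_mul (hf _) (hf _), mul_assoc]
      · simp only [ContinuousMap.coe_mk]
        have : ∀ j, min (0 : I) (c j) = 0 := fun j => min_eq_left (c j).2.1
        rw [this, this, tr_self (hf _), one_mul, a3]
      · simp only [ContinuousMap.coe_mk]
        rw [hz (min s (c k)), hz (min s (c (k + 1))), tr_self (hf _), one_mul, a4 z hz]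
  obtain ⟨F, a1, a2, a3, a4⟩ := hmain (N + 1)
  refine ⟨F, a1, fun p => ?_, a3, a4⟩
  rw [a2 p]
  have : c (N + 1) = 1 := by
    simp only [c]; push_cast; rw [div_self hN0.ne', pI_one]
  rw [this, min_eq_left (show p.1 ≤ 1 from p.1.2.2)]

/-- Complex numbers as quaternions. -/
def qc (c : ℂ) : HH := Quaternion.ofComplex c
lemma qc_mul (a b : ℂ) : qc (a * b) = qc a * qc b := map_mul _ a b
@[simp] lemma qc_one : qc 1 = 1 := map_one Quaternion.ofComplex
lemma continuous_qc : Continuous qc :=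
  Quaternion.ofComplex.toLinearMap.continuous_of_finiteDimensional
lemma qc_ne {c : ℂ} (h : c ≠ 0) : qc c ≠ 0 := by
  intro h0
  apply h
  have : Function.Injective Quaternion.ofComplex := Quaternion.ofComplex.toRingHom.injective
  exact this (h0.trans (map_zero _).symm)
lemma qc_I : qc Complex.I = ii := by ext <;> simp [qc, Quaternion.coe_ofComplex]
lemma qc_comm (c : ℂ) : qc c * ii = ii * qc c := by
  rw [← qc_I, ← qc_mul, ← qc_mul, mul_comm]

/-- The complex part of a quaternion. -/
def cw (q : HH) : ℂ := (q.re : ℂ) + q.imI * Complex.I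
lemma continuous_cw : Continuous cw := by
  have h1 := Quaternion.continuous_re
  have h2 := Quaternion.continuous_imI
  unfold cw
  fun_prop
@[simp] lemma cw_qc (c : ℂ) : cw (qc c) = c := by
  apply Complex.ext <;> simp [cw, qc, Quaternion.coe_ofComplex]
lemma qc_cw {w : HH} (h : w * ii = ii * w) : qc (cw w) = w := by
  have e2 := congrArg (fun q : HH => q.imJ) h
  have e3 := congrArg (fun q : HH => q.imK) h
  simp at e2 e3
  ext
  · simp [cw, qc, Quaternion.coe_ofComplex]
  · simp [cw, qc, Quaternion.coe_ofComplex]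
  · simp [cw, qc, Quaternion.coe_ofComplex]; linarith
  · simp [cw, qc, Quaternion.coe_ofComplex]; linarith

lemma ii_inv {F b : HH} (hF : F ≠ 0) (h : F * ii = b * F) : ii * F⁻¹ = F⁻¹ * b := by
  have : F * (ii * F⁻¹) = F * (F⁻¹ * b) := by
    rw [← mul_assoc, h, mul_assoc, mul_inv_cancel₀ hF, mul_one, ← mul_assoc, mul_inv_cancel₀ hF,
      one_mul]
  exact mul_left_cancel₀ hF this

/-- Two lifts differ by a nonzero complex number. -/
lemma lift_diff {F F' b : HH} (hF : F ≠ 0) (hF' : F' ≠ 0) (h : F * ii = b * F)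
    (h' : F' * ii = b * F') : cw (F⁻¹ * F') ≠ 0 ∧ F' = F * qc (cw (F⁻¹ * F')) := by
  have h1 : F⁻¹ * F' * ii = ii * (F⁻¹ * F') := by
    rw [mul_assoc, h', ← mul_assoc, ← mul_assoc, ii_inv hF h]
  have h2 := qc_cw h1
  constructor
  · intro h0
    rw [h0] at h2
    have h3 : qc 0 = 0 := map_zero Quaternion.ofComplex
    rw [h3] at h2
    exact mul_ne_zero (inv_ne_zero hF) hF' h2.symm
  · rw [h2, ← mul_assoc, mul_inv_cancel₀ hF, one_mul]

lemma lift_mul {F b : HH} (h : F * ii = b * F) (c : ℂ) : F * qc c * ii = b * (F * qc c) := by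
  rw [mul_assoc, qc_comm, ← mul_assoc, h, mul_assoc]

lemma log_const {A : Type} [TopologicalSpace A] [PreconnectedSpace A] (l : C(A, ℂ))
    (h : ∀ s t, Complex.exp (l s) = Complex.exp (l t)) (s t : A) : l s = l t :=
  Complex.isCoveringMap_exp.const_of_comp l.continuous (fun a b => Subtype.ext (h a b)) s t

lemma log_lift {Z : Type} [TopologicalSpace Z] (u : C(I × Z, ℂ)) (hu : ∀ p, u p ≠ 0)
    (l0 : C(Z, ℂ)) (h0 : ∀ z, Complex.exp (l0 z) = u (0, z)) :
    ∃ l : C(I × Z, ℂ), (∀ p, Complex.exp (l p) = u p) ∧ ∀ z, l (0, z) = l0 z := by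
  let H : C(I × Z, {z : ℂ // z ≠ 0}) := ⟨fun p => ⟨u p, hu p⟩, by fun_prop⟩
  have hH : ∀ a, H (0, a) = ⟨_, (l0 a).exp_ne_zero⟩ := fun a => Subtype.ext (h0 a).symm
  refine ⟨Complex.isCoveringMap_exp.liftHomotopy H l0 hH, fun p => ?_, fun z => ?_⟩
  · have := congrFun (Complex.isCoveringMap_exp.liftHomotopy_lifts H l0 hH) p
    exact congrArg Subtype.val this
  · exact Complex.isCoveringMap_exp.liftHomotopy_zero H l0 hH z

/-- Logarithms on cubes. -/
lemma log_cube {n : ℕ} (u : C(Fin (n + 2) → I, ℂ)) (hu : ∀ y, u y ≠ 0)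
    (hb : ∀ y ∈ Cube.boundary (Fin (n + 2)), u y = 1) :
    ∃ l : C(Fin (n + 2) → I, ℂ), (∀ y, Complex.exp (l y) = u y) ∧
      ∀ y ∈ Cube.boundary (Fin (n + 2)), l y = 0 := by
  have hz : (fun _ => 0 : Fin (n + 2) → I) ∈ Cube.boundary (Fin (n + 2)) := ⟨0, Or.inl rfl⟩
  obtain ⟨L, h1, h2⟩ := log_lift (⟨fun p => u (fun i => p.1 * p.2 i), by fun_prop⟩ :
      C(I × (Fin (n + 2) → I), ℂ)) (fun p => hu _) (ContinuousMap.const _ 0) (fun z => by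
    simp [hb _ hz])
  let l : C(Fin (n + 2) → I, ℂ) := ⟨fun y => L (1, y), by fun_prop⟩
  have hl : ∀ y, Complex.exp (l y) = u y := fun y => by simp [l, h1]
  have l0 : l (fun _ => 0) = 0 := by
    have := log_const (⟨fun s => L (s, fun _ => 0), by fun_prop⟩ : C(I, ℂ))
      (fun s t => by simp [h1]) 1 0
    simp only [ContinuousMap.coe_mk] at this
    change L (1, _) = 0
    rw [this, h2]; rfl
  have key : ∀ γ : C(I, Fin (n + 2) → I), (∀ s, γ s ∈ Cube.boundary (Fin (n + 2))) →
      l (γ 1) = l (γ 0) := fun γ hγ => log_const (l.comp γ) (fun s t => by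
    simp [hl, hb _ (hγ _)]) 1 0
  have s1 : ∀ y i, y i = 0 → l y = 0 := by
    intro y i hi
    have := key ⟨fun s j => s * y j, by fun_prop⟩ (fun s => ⟨i, by simp [hi]⟩)
    simpa [l0] using this
  refine ⟨l, hl, ?_⟩
  rintro y ⟨i, hi | hi⟩
  · exact s1 y i hi
  · obtain ⟨j, hj⟩ := exists_ne i
    have := key ⟨fun s => Function.update y j (s * y j), by fun_prop⟩
      (fun s => ⟨i, by simp [Function.update_of_ne hj.symm, hi]⟩)
    simp only [ContinuousMap.coe_mk, one_mul, Function.update_eq_self, zero_mul] at this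
    rw [this]
    exact s1 _ j (by simp)

end HopfPf

namespace HopfPf
open scoped unitInterval Quaternion Topology.Homotopy

/-! ## Part 5: the Hopf map induces an isomorphism -/

lemma push_iso {W W' : Type} [TopologicalSpace W] [TopologicalSpace W'] {n : ℕ} {U : Set W}
    {U' : Set W'} {e : W} {e' : W'} (φ : W → W') (hc : ContinuousOn φ U) (hm : MapsTo φ U U')
    (hφ : φ e = e') (he : e ∈ U) (he' : e' ∈ U')
    (surj : ∀ f' : C(Fin (n + 1) → I, W'), IsLoop U' e' f' → ∃ f : C(Fin (n + 1) → I, W),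
      IsLoop U e f ∧ ∀ y, φ (f y) = f' y)
    (ker : ∀ f : C(Fin (n + 1) → I, W), IsLoop U e f → ∀ H : C(I × (Fin (n + 1) → I), W'),
      (∀ y, H (0, y) = φ (f y)) → (∀ y, H (1, y) = e') → (∀ p, H p ∈ U') →
      (∀ t, ∀ y ∈ Cube.boundary (Fin (n + 1)), H (t, y) = e') →
      IsHtpy U e f (ContinuousMap.const _ e)) :
    Nonempty (π_ (n + 1) U (⟨e, he⟩ : U) ≃* π_ (n + 1) U' (⟨e', he'⟩ : U')) := by
  have push : ∀ f : C(Fin (n + 1) → I, W), IsLoop U e f → ∃ f' : C(Fin (n + 1) → I, W'),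
      IsLoop U' e' f' ∧ ∀ y, φ (f y) = f' y := fun f hf =>
    ⟨⟨fun y => φ (f y), hc.comp_continuous f.continuous hf.1⟩,
      ⟨fun y => hm (hf.1 y), fun y hy => by simp [hf.2 y hy, hφ]⟩, fun y => rfl⟩
  apply rel_mulEquiv (fun a b => ∃ f f', ∃ (hf : IsLoop U e f) (hf' : IsLoop U' e' f'),
    (∀ y, φ (f y) = f' y) ∧ a = cls he f hf ∧ b = cls he' f' hf')
  · intro a
    obtain ⟨f, hf, rfl⟩ := exists_cls he a
    obtain ⟨f', h1, h2⟩ := push f hf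
    exact ⟨_, f, f', hf, h1, h2, rfl, rfl⟩
  · rintro a b b' ⟨f, f', hf, hf', h1, rfl, rfl⟩ ⟨g, g', hg, hg', h1', h2, rfl⟩
    rw [cls_eq] at h2 ⊢
    obtain ⟨H, k0, k1, k2, k3⟩ := h2
    refine ⟨⟨fun p => φ (H p), hc.comp_continuous H.continuous k2⟩, fun y => ?_, fun y => ?_,
      fun p => hm (k2 p), fun t y hy => ?_⟩
    · simp [k0, h1]
    · simp [k1, h1']
    · simp [k3 t y hy, hφ]
  · rintro a a' b b' ⟨f, f', hf, hf', h1, rfl, rfl⟩ ⟨g, g', hg, hg', h1', rfl, rfl⟩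
    obtain ⟨k, hk, c1, e1⟩ := cls_mul he 0 g f hg hf
    obtain ⟨k', hk', h2⟩ := push k hk
    refine ⟨k, k', hk, hk', h2, e1, cls_mul' he' 0 g' f' k' hg' hf' hk' ?_⟩
    intro y
    refine ⟨fun h => ?_, fun h => ?_⟩
    · rw [← h2, (c1 y).1 h, h1']
    · rw [← h2, (c1 y).2 h, h1]
  · intro b
    obtain ⟨f', hf', rfl⟩ := exists_cls he' b
    obtain ⟨f, h1, h2⟩ := surj f' hf'
    exact ⟨_, f, f', h1, hf', h2, rfl, rfl⟩
  · rintro a ⟨f, f', hf, hf', h1, rfl, h2⟩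
    rw [← cls_const he', eq_comm, cls_eq] at h2
    rw [← cls_const he, cls_eq]
    obtain ⟨H, k0, k1, k2, k3⟩ := h2
    exact ker f hf H (fun y => by rw [k0, h1]) k1 k2 k3

/-- The Hopf map. -/
def hopf (q : HH) : HH := q * ii * q⁻¹
lemma hopf_eq {q b : HH} (hq : q ≠ 0) (h : q * ii = b * q) : hopf q = b := by
  rw [hopf, h, mul_assoc, mul_inv_cancel₀ hq, mul_one]
lemma hopf_mul {q : HH} (hq : q ≠ 0) : q * ii = hopf q * q := by
  rw [hopf, mul_assoc, inv_mul_cancel₀ hq, mul_one]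
lemma hopf_SS {q : HH} (hq : q ≠ 0) : hopf q ∈ SS := by
  change q * ii * q⁻¹ * (q * ii * q⁻¹) = -1
  calc q * ii * q⁻¹ * (q * ii * q⁻¹) = q * ii * (q⁻¹ * q) * ii * q⁻¹ := by simp only [mul_assoc]
    _ = q * (ii * ii) * q⁻¹ := by rw [inv_mul_cancel₀ hq, mul_one, mul_assoc q]
    _ = -1 := by rw [ii_sq, mul_neg, mul_one, neg_mul, mul_inv_cancel₀ hq]
lemma continuousOn_hopf : ContinuousOn hopf XX :=
  (continuous_id.mul continuous_const).continuousOn.mul (continuousOn_id.inv₀ fun _ h => h)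

theorem hopf_iso {e b : HH} (he : e ∈ XX) (hb : b ∈ SS) (h : e * ii = b * e) :
    Nonempty (π_ 3 XX (⟨e, he⟩ : XX) ≃* π_ 3 SS (⟨b, hb⟩ : SS)) := by
  have cq := continuous_qc
  have cc := continuous_cw
  have cwe : cw (e⁻¹ * e) = 1 := by rw [inv_mul_cancel₀ he, ← qc_one, cw_qc]
  apply push_iso hopf continuousOn_hopf (fun q hq => hopf_SS hq) (hopf_eq he h)
  · intro f' hf'
    have hfe : ucons (ccons f') = f' := ucons_ccons f'
    have sd : ∀ s x, Side s x → ccons f' (s, x) = b := fun s x hs =>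
      loop_side (by rw [hfe]; exact hf') hs
    obtain ⟨F, a1, a2, a3, a4⟩ := hopf_lift (ccons f') (fun p => hf'.1 _)
      (ContinuousMap.const _ e) (fun _ => he) (fun z => by
        rw [sd _ _ (Or.inl rfl)]; exact h)
    have a5 : ∀ s, ∀ x ∈ Cube.boundary (Fin 2), F (s, x) = e := fun s x hx =>
      a4 x (fun s' => by rw [sd _ _ (Or.inr (Or.inr hx)), sd _ _ (Or.inr (Or.inr hx))]) s
    have hd : ∀ x, _ := fun x => lift_diff he (a1 (1, x)) h
      (by rw [a2, sd 1 x (Or.inr (Or.inl rfl))])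
    obtain ⟨l, l1, l2⟩ := log_cube (n := 0) ⟨fun x => cw (e⁻¹ * F (1, x)), by fun_prop⟩
      (fun x => (hd x).1) (fun x hx => by simp [a5 _ _ hx, cwe])
    let F' : C(I × (Fin 2 → I), HH) :=
      ⟨fun p => F p * qc (Complex.exp (-((p.1 : ℝ) : ℂ) * l p.2)), by fun_prop⟩
    have ne' : ∀ p, F' p ≠ 0 := fun p => mul_ne_zero (a1 p) (qc_ne (Complex.exp_ne_zero _))
    refine ⟨ucons F', isLoop_of_side ne' ?_, ?_⟩
    · rintro s x (rfl | rfl | hx)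
      · simp [F', a3]
      · simp only [F', ContinuousMap.coe_mk, Icc.coe_one, Complex.ofReal_one, neg_mul, one_mul]
        rw [(hd x).2, mul_assoc, ← qc_mul, Complex.exp_neg, l1]
        simp only [ContinuousMap.coe_mk]
        rw [mul_inv_cancel₀ (hd x).1, qc_one, mul_one]
      · simp [F', a5 _ _ hx, l2 x hx]
    · refine cons_cases fun s x => ?_
      rw [ucons_cons]
      exact hopf_eq (ne' _) (lift_mul (a2 (s, x)) _)
  · intro f hf H k0 k1 k2 k3
    obtain ⟨F, a1, a2, a3, a4⟩ := hopf_lift H k2 f hf.1 (fun y => by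
      rw [k0]; exact hopf_mul (hf.1 y))
    have a5 : ∀ s, ∀ x ∈ Cube.boundary (Fin 3), F (s, x) = e := fun s x hx =>
      (a4 x (fun s' => by rw [k3 _ _ hx, k3 _ _ hx]) s).trans (hf.2 x hx)
    have hd : ∀ x, _ := fun x => lift_diff he (a1 (1, x)) h (by rw [a2, k1])
    obtain ⟨l, l1, l2⟩ := log_cube (n := 1) ⟨fun x => cw (e⁻¹ * F (1, x)), by fun_prop⟩
      (fun x => (hd x).1) (fun x hx => by simp [a5 _ _ hx, cwe])
    refine ⟨⟨fun p => F p * qc (Complex.exp (-((p.1 : ℝ) : ℂ) * l p.2)), by fun_prop⟩,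
      fun y => ?_, fun y => ?_, fun p => mul_ne_zero (a1 p) (qc_ne (Complex.exp_ne_zero _)),
      fun t y hy => ?_⟩
    · simp [a3]
    · simp only [ContinuousMap.coe_mk, Icc.coe_one, Complex.ofReal_one, neg_mul, one_mul]
      rw [(hd y).2, mul_assoc, ← qc_mul, Complex.exp_neg, l1]
      simp only [ContinuousMap.coe_mk]
      rw [mul_inv_cancel₀ (hd y).1, qc_one, mul_one]; rfl
    · simp [a5 _ _ hy, l2 y hy]

/-- Imaginary quaternions to Euclidean space. -/
def toE (q : HH) : E3 := !₂[q.imI, q.imJ, q.imK]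
/-- Euclidean space to imaginary quaternions. -/
def ofE (v : E3) : HH := kinv (v 0, v 1, v 2)
lemma continuous_toE : Continuous toE := by
  have h1 := Quaternion.continuous_imI
  have h2 := Quaternion.continuous_imJ
  have h3 := Quaternion.continuous_imK
  unfold toE
  refine (PiLp.continuous_toLp 2 _).comp (continuous_pi fun i => ?_)
  fin_cases i <;> simpa
lemma continuous_ofE : Continuous ofE :=
  (LinearMap.continuous_of_finiteDimensional kinv).comp (by fun_prop)
lemma toE_ofE (v : E3) : toE (ofE v) = v := by
  ext i
  fin_cases i <;> rfl
lemma ofE_toE {q : HH} (h : q.re = 0) : ofE (toE q) = q :=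
  QuaternionAlgebra.ext h.symm rfl rfl rfl
lemma norm_ofE (v : E3) : ‖ofE v‖ = ‖v‖ := by
  have h1 : ‖ofE v‖ ^ 2 = ‖v‖ ^ 2 := by
    rw [sq, ← Quaternion.normSq_eq_norm_mul_self, EuclideanSpace.real_norm_sq_eq,
      Quaternion.normSq_def', Fin.sum_univ_three]
    change (0 : ℝ) ^ 2 + v 0 ^ 2 + v 1 ^ 2 + v 2 ^ 2 = _
    ring
  exact (sq_eq_sq₀ (norm_nonneg _) (norm_nonneg _)).1 h1
lemma ofE_SS {v : E3} (h : v ∈ Metric.sphere (0 : E3) 1) : ofE v ∈ SS :=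
  SS_of rfl (by rw [norm_ofE]; simpa using h)
lemma toE_sphere {q : HH} (h : q ∈ SS) : toE q ∈ Metric.sphere (0 : E3) 1 := by
  rw [mem_sphere_zero_iff_norm, ← norm_ofE, ofE_toE (SS_re h), SS_norm h]

theorem sphere_iso (pt : Sph2) :
    Nonempty (π_ 3 SS (⟨ofE pt, ofE_SS pt.2⟩ : SS) ≃* π_ 3 Sph2 pt) := by
  apply push_iso (n := 2) (e' := (pt : E3)) toE continuous_toE.continuousOn (fun q hq => toE_sphere hq)
    (toE_ofE _) (ofE_SS pt.2) pt.2
  · intro f' hf'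
    exact ⟨⟨fun y => ofE (f' y), continuous_ofE.comp f'.continuous⟩,
      ⟨fun y => ofE_SS (hf'.1 y), fun y hy => by simp [hf'.2 y hy]⟩, fun y => toE_ofE _⟩
  · intro f hf H k0 k1 k2 k3
    refine ⟨⟨fun p => ofE (H p), continuous_ofE.comp H.continuous⟩, fun y => ?_, fun y => ?_,
      fun p => ofE_SS (k2 p), fun t y hy => ?_⟩
    · simp only [ContinuousMap.coe_mk, k0]; exact ofE_toE (SS_re (hf.1 y))
    · simp [k1]
    · simp [k3 t y hy]

/-- The quaternion `j`. -/
def jj : HH := ⟨0, 0, 1, 0⟩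
@[simp] lemma jj_re : jj.re = 0 := rfl
@[simp] lemma jj_imI : jj.imI = 0 := rfl
@[simp] lemma jj_imJ : jj.imJ = 1 := rfl
@[simp] lemma jj_imK : jj.imK = 0 := rfl
lemma jj_ne : jj ≠ 0 := fun h => by simpa [jj] using congrArg (fun q : HH => q.imJ) h

lemma exists_base {b : HH} (hb : b ∈ SS) : ∃ e : HH, e ≠ 0 ∧ e.re = 0 ∧ e * ii = b * e := by
  by_cases h : ii + b = 0
  · refine ⟨jj, jj_ne, rfl, ?_⟩
    rw [eq_neg_of_add_eq_zero_right h]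
    ext <;> simp
  · refine ⟨ii + b, h, by simp [SS_re hb], ?_⟩
    rw [add_mul, mul_add, ii_sq, show b * b = -1 from hb, add_comm]

end HopfPf

namespace HopfPf
open scoped unitInterval Quaternion Topology.Homotopy

/-! ## Part 6: the second homotopy group of the sphere -/

/-- Normalized imaginary part. -/
def nu (q : HH) : HH := ‖q.im‖⁻¹ • q.im

lemma nu_SS {q : HH} (hq : q ∈ YY) : nu q ∈ SS := by
  have : ‖q.im‖ ≠ 0 := norm_ne_zero_iff.2 hq
  apply SS_of
  · simp [nu]
  · rw [nu, norm_smul, norm_inv, norm_norm, inv_mul_cancel₀ this]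

lemma nu_smul {q : HH} (hq : q ∈ YY) : ‖q.im‖ • nu q = q.im := by
  have : ‖q.im‖ ≠ 0 := norm_ne_zero_iff.2 hq
  rw [nu, smul_smul, mul_inv_cancel₀ this, one_smul]

lemma im_SS {q : HH} (hq : q ∈ SS) : q.im = q := by
  ext <;> simp [SS_re hq]

lemma continuousOn_nu : ContinuousOn nu YY := by
  have h := Quaternion.continuous_im
  exact ContinuousOn.smul (ContinuousOn.inv₀ (h.norm.continuousOn)
    fun q hq => norm_ne_zero_iff.2 hq) h.continuousOn

lemma nu_iso {e : HH} (he : e ∈ YY) (hre : e.re = 0) :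
    Nonempty (π_ 2 YY (⟨e, he⟩ : YY) ≃* π_ 2 SS (⟨nu e, nu_SS he⟩ : SS)) := by
  have hie : e.im = e := by ext <;> simp [hre]
  have hne : ‖e.im‖ ≠ 0 := norm_ne_zero_iff.2 he
  have hpe : 0 < ‖e.im‖ := norm_pos_iff.2 he
  have ci := Quaternion.continuous_im
  have cr := Quaternion.continuous_re
  refine push_iso (n := 1) nu continuousOn_nu (fun q hq => nu_SS hq) rfl he (nu_SS he) ?_ ?_
  · intro f' hf'
    refine ⟨⟨fun y => ‖e.im‖ • f' y, by fun_prop⟩, ⟨fun y => ?_, fun y hy => ?_⟩, fun y => ?_⟩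
    · change (‖e.im‖ • f' y).im ≠ 0
      rw [Quaternion.im_smul, im_SS (hf'.1 y)]
      exact smul_ne_zero hne (SS_ne (hf'.1 y))
    · change ‖e.im‖ • f' y = e
      rw [hf'.2 y hy, nu_smul he, hie]
    · change nu (‖e.im‖ • f' y) = f' y
      rw [nu, Quaternion.im_smul, im_SS (hf'.1 y), norm_smul, norm_norm, SS_norm (hf'.1 y),
        mul_one, smul_smul, inv_mul_cancel₀ hne, one_smul]
  · intro f hf H k0 k1 k2 k3
    refine ⟨⟨fun p => (((1 - (p.1 : ℝ)) * (f p.2).re : ℝ) : HH) +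
      ((1 - (p.1 : ℝ)) * ‖(f p.2).im‖ + (p.1 : ℝ) * ‖e.im‖) • H p, ?_⟩, fun y => ?_, fun y => ?_,
      fun p => ?_, fun t y hy => ?_⟩
    · have c1 : Continuous fun p : I × (Fin 2 → I) =>
          (1 - (p.1 : ℝ)) * ‖(f p.2).im‖ + (p.1 : ℝ) * ‖e.im‖ := by fun_prop
      have c2 : Continuous fun p : I × (Fin 2 → I) => (1 - (p.1 : ℝ)) * (f p.2).re := by fun_prop
      exact (Quaternion.continuous_coe.comp c2).add (c1.smul H.continuous)
    · simp only [ContinuousMap.coe_mk, Icc.coe_zero, sub_zero, one_mul, zero_mul, add_zero, k0]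
      rw [nu_smul (hf.1 y)]
      exact Quaternion.re_add_im _
    · simp only [ContinuousMap.coe_mk, Icc.coe_one, sub_self, one_mul, zero_mul, zero_add, k1]
      rw [nu_smul he, hie]; simp
    · change Quaternion.im _ ≠ 0
      simp only [ContinuousMap.coe_mk]
      rw [Quaternion.im_add, Quaternion.im_coe, zero_add, Quaternion.im_smul, im_SS (k2 p)]
      refine smul_ne_zero (ne_of_gt ?_) (SS_ne (k2 p))
      have hfp : 0 < ‖(f p.2).im‖ := norm_pos_iff.2 (hf.1 p.2)
      have a := p.1.2.1
      have b := p.1.2.2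
      rcases a.eq_or_lt with h | h
      · rw [← h]; simpa using hfp
      · have : 0 ≤ (1 - (p.1 : ℝ)) * ‖(f p.2).im‖ := mul_nonneg (by linarith) hfp.le
        have := mul_pos h hpe
        linarith
    · simp only [ContinuousMap.coe_mk]
      rw [hf.2 y hy, k3 t y hy, hre, ← add_mul, sub_add_cancel, one_mul, nu_smul he, hie]
      simp

/-- Vanishing of the second homotopy group of the complement of the origin. -/
lemma null2 {e : HH} (he : e ∈ XX) (hre : e.re = 0) (f : C(Fin 2 → I, HH)) (hf : IsLoop XX e f) :
    IsHtpy XX e f (ContinuousMap.const _ e) := by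
  obtain ⟨f', a1, a2, a3⟩ := gp_low (V := Fin 2 → ℝ) (by simp) (closedEmb_cube 2) f hf.1
  have heY : e ∈ YY := im_ne_of_re he hre
  have hb : ∀ y ∈ Cube.boundary (Fin 2), f' y = e := fun y hy => by
    rw [a2 y (by rw [hf.2 y hy, hre]), hf.2 y hy]
  have hf' : IsLoop XX e f' := ⟨fun y => YY_XX (a3 y), hb⟩
  refine IsHtpy.trans he hf hf' (isLoop_const he) ?_ ?_
  · refine ⟨⟨fun p => f p.2 + (p.1 : ℝ) • (f' p.2 - f p.2), by fun_prop⟩, fun y => ?_, fun y => ?_,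
      fun p => line_ne (a1 p.2) p.1, fun t y hy => ?_⟩
    · simp
    · simp
    · simp [hb y hy, hf.2 y hy]
  · have hc0 : IsClosed {p : I × (Fin 2 → I) | p.1 = 0} :=
      isClosed_eq continuous_fst continuous_const
    have hc1 : IsClosed {p : I × (Fin 2 → I) | p.1 = 1 ∨ p.2 ∈ Cube.boundary (Fin 2)} :=
      (isClosed_eq continuous_fst continuous_const).union
        ((isClosed_bdry 2).preimage continuous_snd)
    classical
    obtain ⟨ψ, b1, b2⟩ := star_ext (Z := I × (Fin 2 → I)) (hc0.union hc1) isOpen_Up one_mem_Up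
      star_Up (fun p => if p.1 = 0 then f' p.2 else e) (by
        refine ContinuousOn.union_of_isClosed ?_ ?_ hc0 hc1
        · refine (f'.continuous.comp continuous_snd).continuousOn.congr fun p hp => ?_
          exact if_pos hp
        · refine (continuous_const (y := e)).continuousOn.congr fun p hp => ?_
          simp only
          split_ifs with h
          · rcases hp with hp | hp
            · rw [h] at hp; exact absurd hp zero_ne_one
            · exact hb _ hp
          · rfl) (by
        intro p _
        split_ifs
        · exact YY_Up (a3 _)
        · exact YY_Up heY)
    refine ⟨ψ, fun y => ?_, fun y => ?_, fun p hp => ?_, fun t y hy => ?_⟩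
    · rw [b2 _ (Or.inl rfl)]; exact if_pos rfl
    · rw [b2 _ (Or.inr (Or.inl rfl))]; exact if_neg one_ne_zero
    · have := b1 p
      rw [hp] at this
      rcases this with h | h <;> simp at h
    · rw [b2 _ (Or.inr (Or.inr hy))]
      simp only
      split_ifs
      · exact hb y hy
      · rfl

/-- `g`, a loop in `SS`, has degree `n`, computed by lifting along the Hopf map. -/
def Wnd (e : HH) (g : C(Fin 2 → I, HH)) (n : ℤ) : Prop :=
  ∃ F : C(I × I, HH), (∀ p, F p ≠ 0) ∧ (∀ s x, F (s, x) * ii = g ![s, x] * F (s, x)) ∧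
    (∀ x, F (0, x) = e) ∧ (∀ s, F (s, 0) = e) ∧ (∀ s, F (s, 1) = e) ∧
    ∃ l : C(I, ℂ), l 0 = 0 ∧ l 1 = n * (2 * Real.pi * Complex.I) ∧
      ∀ x, F (1, x) = e * qc (Complex.exp (l x))

lemma continuous_p2 : Continuous fun p : I × I => (![p.1, p.2] : Fin 2 → I) := by
  refine continuous_pi fun i => ?_
  fin_cases i
  · exact continuous_fst
  · exact continuous_snd

lemma p2_eta (y : Fin 2 → I) : ![y 0, y 1] = y := by
  ext i; fin_cases i <;> rfl

lemma bd2 {s x : I} (h : s = 0 ∨ s = 1 ∨ x = 0 ∨ x = 1) : ![s, x] ∈ Cube.boundary (Fin 2) := by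
  rcases h with h | h | h | h
  · exact ⟨0, Or.inl h⟩
  · exact ⟨0, Or.inr h⟩
  · exact ⟨1, Or.inl h⟩
  · exact ⟨1, Or.inr h⟩

lemma bd2' {y : Fin 2 → I} (h : y ∈ Cube.boundary (Fin 2)) :
    y 0 = 0 ∨ y 0 = 1 ∨ y 1 = 0 ∨ y 1 = 1 := by
  obtain ⟨i, hi⟩ := h
  fin_cases i
  · rcases hi with h | h
    · exact Or.inl h
    · exact Or.inr (Or.inl h)
  · rcases hi with h | h
    · exact Or.inr (Or.inr (Or.inl h))
    · exact Or.inr (Or.inr (Or.inr h))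

lemma wnd_tot {e b : HH} (he : e ∈ XX) (h : e * ii = b * e) (g : C(Fin 2 → I, HH)) (hg : IsLoop SS b g) : ∃ n, Wnd e g n := by
  have cc := continuous_cw
  have cwe : cw (e⁻¹ * e) = 1 := by rw [inv_mul_cancel₀ he, ← qc_one, cw_qc]
  obtain ⟨F, a1, a2, a3, a4⟩ := hopf_lift (Z := I) ⟨fun p => g ![p.1, p.2],
    g.continuous.comp continuous_p2⟩ (fun p => hg.1 _) (ContinuousMap.const _ e) (fun _ => he)
    (fun x => by
      simp only [ContinuousMap.const_apply, ContinuousMap.coe_mk]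
      rw [hg.2 _ (bd2 (Or.inl rfl)), h])
  simp only [ContinuousMap.const_apply, ContinuousMap.coe_mk] at a2 a3 a4
  have b0 : ∀ s, F (s, 0) = e := a4 0 fun s => by
    rw [hg.2 _ (bd2 (by simp)), hg.2 _ (bd2 (by simp))]
  have b1 : ∀ s, F (s, 1) = e := a4 1 fun s => by
    rw [hg.2 _ (bd2 (by simp)), hg.2 _ (bd2 (by simp))]
  have hd : ∀ x, _ := fun x => lift_diff he (a1 (1, x)) h (by rw [a2, hg.2 _ (bd2 (by simp))])
  obtain ⟨l, l1, l2⟩ := log_lift (Z := PUnit) ⟨fun p => cw (e⁻¹ * F (1, p.1)), by fun_prop⟩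
    (fun p => (hd p.1).1) (ContinuousMap.const _ 0) (fun z => by simp [b0, cwe])
  have h1 : Complex.exp (l (1, PUnit.unit)) = 1 := by rw [l1]; simp [b1, cwe]
  obtain ⟨n, hn⟩ := Complex.exp_eq_one_iff.1 h1
  refine ⟨n, F, a1, fun s x => a2 (s, x), a3, b0, b1, ⟨fun x => l (x, PUnit.unit), by fun_prop⟩,
    l2 _, hn, fun x => ?_⟩
  simp only [ContinuousMap.coe_mk]
  rw [l1]
  exact (hd x).2

lemma wnd_fn {e b : HH} (he : e ∈ XX) (g g' : C(Fin 2 → I, HH))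
    (H : IsHtpy SS b g g') (n n' : ℤ) (hn : Wnd e g n) (hn' : Wnd e g' n') : n = n' := by
  have cc := continuous_cw
  obtain ⟨H, k0, k1, k2, k3⟩ := H
  obtain ⟨F, a1, a2, a3, a4, a5, l, l0, l1, l2⟩ := hn
  obtain ⟨F', a1', a2', a3', a4', a5', l', l0', l1', l2'⟩ := hn'
  obtain ⟨G, c1, c2, c3, c4⟩ := hopf_lift (Z := I × I) ⟨fun p => H (p.1, ![p.2.1, p.2.2]),
    H.continuous.comp (continuous_fst.prodMk (continuous_p2.comp continuous_snd))⟩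
    (fun p => k2 _) F a1 (fun p => by
      simp only [ContinuousMap.coe_mk]
      rw [k0]; exact a2 _ _)
  simp only [ContinuousMap.coe_mk] at c2 c4
  have c5 : ∀ s x, (s = 0 ∨ s = 1 ∨ x = 0 ∨ x = 1) → G (1, (s, x)) = F (s, x) := fun s x hs =>
    c4 (s, x) (fun t => by rw [k3 _ _ (bd2 hs), k3 _ _ (bd2 hs)]) 1
  have hd : ∀ p : I × I, _ := fun p => lift_diff (c1 (1, p)) (a1' p) (c2 (1, p)) (by
    rw [show (1, p).2.1 = p.1 from rfl, show (1, p).2.2 = p.2 from rfl, k1]; exact a2' p.1 p.2)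
  let v : C(I × I, ℂ) := ⟨fun p => cw ((G (1, p))⁻¹ * F' p), by
    have : Continuous fun p : I × I => (G (1, p))⁻¹ :=
      Continuous.inv₀ (by fun_prop) fun p => c1 _
    fun_prop⟩
  have v1 : ∀ p, G (1, p) = F' p → v p = 1 := fun p hp => by
    simp only [v, ContinuousMap.coe_mk]
    rw [hp, inv_mul_cancel₀ (a1' p), ← qc_one, cw_qc]
  have w0 : ∀ x, v (0, x) = 1 := fun x => v1 _ (by rw [c5 _ _ (by simp), a3, a3'])
  have w1 : ∀ s, v (s, 0) = 1 := fun x => v1 _ (by rw [c5 _ _ (by simp), a4, a4'])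
  have w2 : ∀ s, v (s, 1) = 1 := fun x => v1 _ (by rw [c5 _ _ (by simp), a5, a5'])
  obtain ⟨m, m1, m2⟩ := log_lift v (fun p => (hd p).1) (ContinuousMap.const _ 0)
    (fun x => by simp [w0])
  have m3 : m (1, 0) = 0 := by
    refine (log_const (⟨fun s => m (s, 0), by fun_prop⟩ : C(I, ℂ)) (fun s t => ?_) 1 0).trans (m2 0)
    simp [m1, w1]
  have m4 : m (1, 1) = 0 := by
    refine (log_const (⟨fun s => m (s, 1), by fun_prop⟩ : C(I, ℂ)) (fun s t => ?_) 1 0).trans (m2 1)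
    simp [m1, w2]
  have key : ∀ x, Complex.exp (l x + m (1, x) - l' x) = 1 := fun x => by
    have h1 := (hd (1, x)).2
    have h2 : Complex.exp (m (1, x)) = cw ((G (1, (1, x)))⁻¹ * F' (1, x)) := m1 (1, x)
    rw [← h2, c5 _ _ (by simp), l2, l2', mul_assoc, ← qc_mul] at h1
    have h3 := congrArg cw (mul_left_cancel₀ he h1)
    rw [cw_qc, cw_qc] at h3
    rw [Complex.exp_sub, Complex.exp_add, h3, div_self (by rw [← h3]; simp)]
  have := log_const (⟨fun x => l x + m (1, x) - l' x, by fun_prop⟩ : C(I, ℂ))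
    (fun s t => by simp only [ContinuousMap.coe_mk]; rw [key, key]) 1 0
  simp only [ContinuousMap.coe_mk, l0, l0', l1, l1', m3, m4] at this
  have hne : (2 * Real.pi * Complex.I : ℂ) ≠ 0 := Complex.two_pi_I_ne_zero
  have h5 : ((n : ℂ) - n') * (2 * Real.pi * Complex.I) = 0 := by linear_combination this
  have h6 := (mul_eq_zero.1 h5).resolve_right hne
  exact_mod_cast sub_eq_zero.1 h6

lemma cat_exists {A W : Type} [TopologicalSpace A] [TopologicalSpace W] (F G : C(A × I, W))
    (h : ∀ a, F (a, 1) = G (a, 0)) : ∃ K : C(A × I, W),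
      ∀ a x, (x ≤ half → K (a, x) = F (a, d0 x)) ∧ (half ≤ x → K (a, x) = G (a, d1 x)) := by
  have c0 := continuous_d0
  have c1 := continuous_d1
  refine ⟨⟨fun p => if p.2 ≤ half then F (p.1, d0 p.2) else G (p.1, d1 p.2), ?_⟩, fun a x =>
    ⟨fun hx => if_pos hx, fun hx => ?_⟩⟩
  · refine Continuous.if_le (by fun_prop) (by fun_prop) (by fun_prop) (by fun_prop) ?_
    rintro ⟨a, x⟩ hx
    simp only at hx
    simp only [hx, d0_half, d1_half, h]
  · simp only [ContinuousMap.coe_mk]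
    split_ifs with h'
    · have : x = half := le_antisymm h' hx
      simp [this, h]
    · rfl

lemma wnd_mul {e : HH} (f g k : C(Fin 2 → I, HH)) (hk : IsCat 1 f g k) (n m : ℤ)
    (hf : Wnd e f n) (hg : Wnd e g m) : Wnd e k (n + m) := by
  obtain ⟨F, a1, a2, a3, a4, a5, l, l0, l1, l2⟩ := hf
  obtain ⟨F', a1', a2', a3', a4', a5', l', l0', l1', l2'⟩ := hg
  obtain ⟨K, hK⟩ := cat_exists F F' (fun s => by rw [a5, a4'])
  obtain ⟨q, hq⟩ := cat_exists (A := PUnit) ⟨fun p => l p.2, by fun_prop⟩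
    ⟨fun p => l 1 + l' p.2, by fun_prop⟩ (fun s => by simp [l0'])
  have up : ∀ s x z : I, Function.update ![s, x] 1 z = ![s, z] := fun s x z => by
    ext i; fin_cases i <;> rfl
  have h0 : (0 : I) ≤ half := by exact bot_le
  have h1 : half ≤ (1 : I) := by exact le_top
  refine ⟨K, ?_, fun s x => ?_, fun x => ?_, fun s => ?_, fun s => ?_,
    ⟨fun x => q (PUnit.unit, x), by fun_prop⟩, ?_, ?_, fun x => ?_⟩
  · rintro ⟨s, x⟩
    rcases le_total x half with hx | hx
    · rw [(hK s x).1 hx]; exact a1 _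
    · rw [(hK s x).2 hx]; exact a1' _
  · rcases le_total x half with hx | hx
    · rw [(hK s x).1 hx, a2, (hk ![s, x]).1 hx, up]; rfl
    · rw [(hK s x).2 hx, a2', (hk ![s, x]).2 hx, up]; rfl
  · rcases le_total x half with hx | hx
    · rw [(hK _ x).1 hx, a3]
    · rw [(hK _ x).2 hx, a3']
  · rw [(hK s 0).1 h0, d0_zero, a4]
  · rw [(hK s 1).2 h1, d1_one, a5']
  · simp only [ContinuousMap.coe_mk]
    rw [(hq _ 0).1 h0, d0_zero]; exact l0
  · simp only [ContinuousMap.coe_mk]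
    rw [(hq _ 1).2 h1, d1_one]
    simp only [ContinuousMap.coe_mk, l1, l1']
    push_cast; ring
  · simp only [ContinuousMap.coe_mk]
    rcases le_total x half with hx | hx
    · rw [(hK _ x).1 hx, (hq _ x).1 hx, l2]; rfl
    · rw [(hK _ x).2 hx, (hq _ x).2 hx, l2']
      simp only [ContinuousMap.coe_mk, l1]
      rw [Complex.exp_add, Complex.exp_int_mul_two_pi_mul_I, one_mul]

lemma wnd_ker {e b : HH} (he : e ∈ XX) (hre : e.re = 0) (h : e * ii = b * e)
    (g : C(Fin 2 → I, HH)) (hg : Wnd e g 0) :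
    IsHtpy SS b g (ContinuousMap.const _ b) := by
  have cq := continuous_qc
  obtain ⟨F, a1, a2, a3, a4, a5, l, l0, l1, l2⟩ := hg
  rw [Int.cast_zero, zero_mul] at l1
  let f : C(Fin 2 → I, HH) :=
    ⟨fun y => F (y 0, y 1) * qc (Complex.exp (-((y 0 : ℝ) : ℂ) * l (y 1))), by fun_prop⟩
  have f0 : ∀ y, f y ≠ 0 := fun y => mul_ne_zero (a1 _) (qc_ne (Complex.exp_ne_zero _))
  have hf : IsLoop XX e f := by
    refine ⟨f0, fun y hy => ?_⟩
    simp only [f, ContinuousMap.coe_mk]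
    rcases bd2' hy with h | h | h | h
    · simp [h, a3]
    · rw [h, l2, mul_assoc, ← qc_mul, ← Complex.exp_add]; simp
    · simp [h, a4, l0]
    · simp [h, a5, l1]
  obtain ⟨H, k0, k1, k2, k3⟩ := null2 he hre f hf
  refine ⟨⟨fun p => hopf (H p), continuousOn_hopf.comp_continuous H.continuous k2⟩,
    fun y => ?_, fun y => ?_, fun p => hopf_SS (k2 p), fun t y hy => ?_⟩
  · simp only [ContinuousMap.coe_mk, k0]
    apply hopf_eq (f0 y)
    have := a2 (y 0) (y 1)
    rw [p2_eta] at this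
    exact lift_mul this _
  · simp only [ContinuousMap.coe_mk, k1]
    exact hopf_eq he h
  · simp only [ContinuousMap.coe_mk, k3 t y hy]
    exact hopf_eq he h

lemma wnd_surj {e b : HH} (he : e ∈ XX) (h : e * ii = b * e) (n : ℤ) :
    ∃ g, IsLoop SS b g ∧ Wnd e g n := by
  have cq := continuous_qc
  let c : I × I → ℂ := fun p => (1 - ((p.1 : ℝ) : ℂ)) +
    ((p.1 : ℝ) : ℂ) * Complex.exp (((p.2 : ℝ) : ℂ) * (n * (2 * Real.pi * Complex.I)))
  let r : I × I → ℝ := fun p => (p.1 : ℝ) * (1 - p.1) * ((p.2 : ℝ) * (1 - p.2))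
  let F : C(I × I, HH) := ⟨fun p => e * (qc (c p) + r p • jj), by fun_prop⟩
  have c0 : ∀ x, c (0, x) = 1 := fun x => by simp [c]
  have c1 : ∀ s, c (s, 0) = 1 := fun x => by simp [c]
  have c2 : ∀ s, c (s, 1) = 1 := fun x => by simp [c, Complex.exp_int_mul_two_pi_mul_I]
  have c3 : ∀ x, c (1, x) = Complex.exp (((x : ℝ) : ℂ) * (n * (2 * Real.pi * Complex.I))) :=
    fun x => by simp [c]
  have bd : ∀ s x, (s = 0 ∨ s = 1 ∨ x = 0 ∨ x = 1) → r (s, x) = 0 ∧ c (s, x) ≠ 0 := by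
    rintro s x (rfl | rfl | rfl | rfl)
    · simp [c0, r]
    · simp [c3, r]
    · simp [c1, r]
    · simp [c2, r]
  have hF : ∀ p, F p ≠ 0 := by
    rintro ⟨s, x⟩ h0
    have h1 := (mul_eq_zero.1 h0).resolve_left he
    have h2 : r (s, x) = 0 := by
      have := congrArg (fun q : HH => q.imJ) h1
      simpa [qc, Quaternion.coe_ofComplex] using this
    have h3 : s = 0 ∨ s = 1 ∨ x = 0 ∨ x = 1 := by
      simp only [r, mul_eq_zero, sub_eq_zero] at h2
      rcases h2 with (h | h) | (h | h)
      · exact Or.inl (Subtype.ext h)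
      · exact Or.inr (Or.inl (Subtype.ext h.symm))
      · exact Or.inr (Or.inr (Or.inl (Subtype.ext h)))
      · exact Or.inr (Or.inr (Or.inr (Subtype.ext h.symm)))
    rw [h2, zero_smul, add_zero] at h1
    exact qc_ne (bd s x h3).2 h1
  have hFb : ∀ s x, (s = 0 ∨ s = 1 ∨ x = 0 ∨ x = 1) → F (s, x) = e * qc (c (s, x)) :=
    fun s x hs => by simp [F, (bd s x hs).1]
  let g : C(Fin 2 → I, HH) := ⟨fun y => hopf (F (y 0, y 1)),
    continuousOn_hopf.comp_continuous (by fun_prop) fun y => hF _⟩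
  refine ⟨g, ⟨fun y => hopf_SS (hF _), fun y hy => ?_⟩, F, hF, fun s x => hopf_mul (hF _),
    fun x => ?_, fun s => ?_, fun s => ?_,
    ⟨fun x => ((x : ℝ) : ℂ) * (n * (2 * Real.pi * Complex.I)), by fun_prop⟩, ?_, ?_, fun x => ?_⟩
  · refine hopf_eq (hF _) ?_
    rw [hFb _ _ (bd2' hy)]
    exact lift_mul h _
  · rw [hFb _ _ (by simp), c0, qc_one, mul_one]
  · rw [hFb _ _ (by simp), c1, qc_one, mul_one]
  · rw [hFb _ _ (by simp), c2, qc_one, mul_one]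
  · simp
  · simp
  · rw [hFb _ _ (by simp), c3]; rfl

lemma deg_iso {b : HH} (hb : b ∈ SS) :
    Nonempty (π_ 2 SS (⟨b, hb⟩ : SS) ≃* Multiplicative ℤ) := by
  obtain ⟨e, he, hre, h⟩ := exists_base hb
  apply rel_mulEquiv (fun a n => ∃ g, ∃ hg : IsLoop SS b g, a = cls hb g hg ∧ Wnd e g n.toAdd)
  · intro a
    obtain ⟨g, hg, rfl⟩ := exists_cls hb a
    obtain ⟨n, hn⟩ := wnd_tot he h g hg
    exact ⟨Multiplicative.ofAdd n, g, hg, rfl, hn⟩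
  · rintro a n n' ⟨g, hg, rfl, h1⟩ ⟨g', hg', h2, h1'⟩
    exact Multiplicative.toAdd.injective (wnd_fn he g g' (cls_eq.1 h2) _ _ h1 h1')
  · rintro a a' n n' ⟨g, hg, rfl, h1⟩ ⟨g', hg', rfl, h1'⟩
    obtain ⟨k, hk, c1, e1⟩ := cls_mul hb 1 g' g hg' hg
    refine ⟨k, hk, e1, ?_⟩
    rw [toAdd_mul, add_comm]
    exact wnd_mul g' g k c1 _ _ h1' h1
  · intro n
    obtain ⟨g, hg, h1⟩ := wnd_surj he h n.toAdd
    exact ⟨_, g, hg, rfl, h1⟩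
  · rintro a ⟨g, hg, rfl, h1⟩
    rw [← cls_const hb, cls_eq]
    exact wnd_ker he hre h g h1

theorem final (pt : Sph2) : Nonempty ((π_ 3) Sph2 pt ≃* Multiplicative ℤ) := by
  obtain ⟨e, he, hre, h⟩ := exists_base (ofE_SS pt.2)
  have heY : e ∈ YY := im_ne_of_re he hre
  obtain ⟨i1⟩ := sphere_iso pt
  obtain ⟨i2⟩ := hopf_iso he (ofE_SS pt.2) h
  obtain ⟨i3⟩ := susp_iso heY hre he
  obtain ⟨i4⟩ := nu_iso heY hre
  obtain ⟨i5⟩ := deg_iso (nu_SS heY)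
  exact ⟨i1.symm.trans (i2.symm.trans (i3.symm.trans (i4.trans i5)))⟩

end HopfPf

/-- The third homotopy group of the 2-sphere is isomorphic to the integers:
`π₃(S²) ≅ ℤ` (for any basepoint). -/
theorem pi3_sphere2_iso_int (pt : Sph2) :
    Nonempty ((π_ 3) Sph2 pt ≃* Multiplicative ℤ) := by
  exact HopfPf.final pt
end
end

section
/- The Hopf map ζ : S³ → S² is not homotopic to a constant map. -/
noncomputable section
open scoped Manifold Topology
open Metric Set

/-- The 3-sphere, as the unit sphere in `ℂ²`. -/
abbrev Sph3c := Metric.sphere (0 : EuclideanSpace ℂ (Fin 2)) 1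

section Analytic
variable {E : Type*} [NormedAddCommGroup E] [InnerProductSpace ℝ E] [FiniteDimensional ℝ E]

/-- Lagrange interpolation of `t ↦ det (1 + t A)`. -/
lemma exists_weights (t : ℕ → ℝ) (ht : Function.Injective t) :
    ∃ w : ℕ → ℝ, ∃ N : ℕ, (∑ i ∈ Finset.range N, w i = 1) ∧ ∀ A : E →L[ℝ] E,
      (1 + A).det = ∑ i ∈ Finset.range N, w i * (1 + t i • A).det := by
  classical
  set n := Module.finrank ℝ E
  let b := Module.finBasis ℝ E
  refine ⟨fun i => (Lagrange.basis (Finset.range (n+1)) t i).eval 1, n+1, ?_, ?_⟩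
  · rw [← Polynomial.eval_finsetSum, Lagrange.sum_basis ht.injOn (by simp)]
    simp
  · intro A
    let M := LinearMap.toMatrix b b (A : E →ₗ[ℝ] E)
    let p : Polynomial ℝ := Matrix.det ((Polynomial.X : Polynomial ℝ) • M.map Polynomial.C
      + (1 : Matrix _ _ ℝ).map Polynomial.C)
    have hp : ∀ s : ℝ, p.eval s = (1 + s • A).det := by
      intro s
      have h1 : (1 + s • A).det = Matrix.det (1 + s • M) := by
        rw [ContinuousLinearMap.det, ← LinearMap.det_toMatrix b]
        congr 1
        simp [M, ContinuousLinearMap.toLinearMap_add, LinearMap.toMatrix_one]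
      rw [h1, ← Polynomial.coe_evalRingHom, RingHom.map_det]
      congr 1
      ext i j
      by_cases hij : i = j
      · simp [Matrix.add_apply, Matrix.one_apply, hij, add_comm]; exact mul_comm _ _
      · simp [Matrix.add_apply, Matrix.one_apply, hij]; exact mul_comm _ _
    have hdeg : p.degree < (Finset.range (n+1)).card := by
      have := Polynomial.natDegree_det_X_add_C_le M (1 : Matrix _ _ ℝ)
      refine lt_of_le_of_lt Polynomial.degree_le_natDegree ?_
      simp only [Finset.card_range]
      simp only [Fintype.card_fin] at this
      exact_mod_cast Nat.lt_succ_of_le this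
    have key := Lagrange.eq_interpolate (s := Finset.range (n+1)) ht.injOn hdeg
    have := congrArg (Polynomial.eval 1) key
    rw [hp, one_smul, Lagrange.interpolate_apply, Polynomial.eval_finsetSum] at this
    rw [this]
    refine Finset.sum_congr rfl fun i _ => ?_
    rw [Polynomial.eval_mul, Polynomial.eval_C, hp, mul_comm]

/-- Extension by zero of a Lipschitz map on the unit ball vanishing on the unit sphere. -/
lemma lipschitz_ext {u : E → E} {K : NNReal} (hu : LipschitzOnWith K u (closedBall 0 1))
    (h0 : ∀ x, ‖x‖ = 1 → u x = 0) :
    LipschitzWith K (indicator (ball (0:E) 1) u) := by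
  have main : ∀ x y : E, ‖x‖ < 1 → 1 ≤ ‖y‖ → ‖u x‖ ≤ K * dist x y := by
    intro x y hx hy
    have hc : ContinuousOn (fun s : ℝ => ‖AffineMap.lineMap x y s‖) (Icc 0 1) := by
      apply Continuous.continuousOn
      exact (AffineMap.lineMap_continuous).norm
    obtain ⟨s, hs, hs1⟩ := intermediate_value_Icc (zero_le_one) hc
      (show (1:ℝ) ∈ _ by simp [hx.le, hy])
    simp only at hs1
    set z : E := AffineMap.lineMap x y s
    have h := hu.dist_le_mul x (by simp [hx.le]) z (by simp [hs1])
    rw [h0 z hs1, dist_zero_right] at h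
    refine h.trans ?_
    gcongr
    rw [dist_left_lineMap, Real.norm_of_nonneg hs.1]
    exact mul_le_of_le_one_left dist_nonneg hs.2
  refine LipschitzWith.of_dist_le_mul fun x y => ?_
  by_cases hx : ‖x‖ < 1 <;> by_cases hy : ‖y‖ < 1
  · rw [indicator_of_mem (by simpa), indicator_of_mem (by simpa)]
    exact hu.dist_le_mul x (by simp [hx.le]) y (by simp [hy.le])
  · rw [indicator_of_mem (by simpa), indicator_of_notMem (by simpa using hy)]
    simpa using main x y hx (not_lt.1 hy)
  · rw [indicator_of_notMem (by simpa using hx), indicator_of_mem (by simpa)]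
    simpa [dist_comm] using main y x hy (not_lt.1 hx)
  · rw [indicator_of_notMem (by simpa using hx), indicator_of_notMem (by simpa using hy)]
    simp; positivity

lemma image_ball {u : E → E} {K : NNReal} (hu : LipschitzOnWith K u (closedBall 0 1))
    (h0 : ∀ x, ‖x‖ = 1 → u x = 0) {t : ℝ} (ht0 : 0 ≤ t) (ht : t * K < 1) :
    InjOn (fun x => x + t • u x) (ball 0 1) ∧ (fun x => x + t • u x) '' ball 0 1 = ball 0 1 := by
  set v := indicator (ball (0:E) 1) u with hv
  have hL := lipschitz_ext hu h0
  have hA : ApproximatesLinearOn (fun x => x + t • v x)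
      ((ContinuousLinearEquiv.refl ℝ E : E ≃L[ℝ] E) : E →L[ℝ] E) univ (t.toNNReal * K) := by
    intro x _ y _
    have : x + t • v x - (y + t • v y) - ((ContinuousLinearEquiv.refl ℝ E : E ≃L[ℝ] E) : E →L[ℝ] E) (x - y)
      = t • (v x - v y) := by
      simp only [smul_sub, ContinuousLinearEquiv.coe_coe, ContinuousLinearEquiv.coe_refl', id]
      abel
    simp only [this, norm_smul, Real.norm_of_nonneg ht0]
    have := hL.dist_le_mul x y
    rw [dist_eq_norm, dist_eq_norm] at this
    rw [NNReal.coe_mul, Real.coe_toNNReal t ht0, mul_assoc]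
    gcongr
  have hc : Subsingleton E ∨ (t.toNNReal * K : NNReal) <
      ‖((ContinuousLinearEquiv.refl ℝ E).symm : E →L[ℝ] E)‖₊⁻¹ := by
    rcases subsingleton_or_nontrivial E with h | h
    · exact Or.inl h
    · right
      have : ‖((ContinuousLinearEquiv.refl ℝ E).symm : E →L[ℝ] E)‖₊ = 1 := by
        have : ((ContinuousLinearEquiv.refl ℝ E).symm : E →L[ℝ] E) = ContinuousLinearMap.id ℝ E := rfl
        rw [this]; simp
      rw [this, inv_one, ← NNReal.coe_lt_coe]
      rw [NNReal.coe_mul, Real.coe_toNNReal t ht0]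
      simpa using ht
  have hsurj := hA.surjective hc
  have hinj : Function.Injective (fun x => x + t • v x) := by
    rw [← injOn_univ]; exact hA.injOn hc
  have heq : EqOn (fun x => x + t • v x) (fun x => x + t • u x) (ball 0 1) := by
    intro x hx
    simp [hv, indicator_of_mem hx]
  have hout : ∀ x, x ∉ ball (0:E) 1 → x + t • v x = x := by
    intro x hx
    simp [hv, indicator_of_notMem hx]
  refine ⟨hinj.injOn.congr heq, ?_⟩
  rw [← heq.image_eq]
  ext y
  constructor
  · rintro ⟨x, hx, rfl⟩
    by_contra hy
    have := hinj (hout _ hy)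
    exact hy (by simp only [this]; exact hx)
  · intro hy
    obtain ⟨x, hx⟩ := hsurj y
    refine ⟨x, ?_, hx⟩
    by_contra h
    simp only [hout x h] at hx
    exact h (hx ▸ hy)

/-- There is no `C¹` retraction of the ball onto the sphere (Milnor–Rogers). -/
theorem no_smooth_retraction {f : E → E} (hf : ContDiff ℝ 1 f) (h1 : ∀ x, ‖f x‖ = 1)
    (hS : ∀ x, ‖x‖ = 1 → f x = x) : False := by
  let _ : MeasurableSpace E := borel E
  have : BorelSpace E := ⟨rfl⟩
  let μ : MeasureTheory.Measure E := MeasureTheory.Measure.addHaar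
  set u : E → E := fun x => f x - x with hudef
  have hu : ContDiff ℝ 1 u := hf.sub contDiff_id
  have hu0 : ∀ x, ‖x‖ = 1 → u x = 0 := fun x hx => by simp [hudef, hS x hx]
  have hcomp : IsCompact (closedBall (0:E) 1) := isCompact_closedBall 0 1
  have hdc : Continuous (fderiv ℝ u) := hu.continuous_fderiv one_ne_zero
  have hdiff : Differentiable ℝ u := hu.differentiable one_ne_zero
  obtain ⟨C, hC⟩ := hcomp.exists_bound_of_continuousOn hdc.continuousOn
  have hC0 : 0 ≤ C := (norm_nonneg _).trans (hC 0 (by simp))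
  have hLip : LipschitzOnWith ⟨C, hC0⟩ u (closedBall 0 1) := by
    refine Convex.lipschitzOnWith_of_nnnorm_fderiv_le (𝕜 := ℝ) (fun x _ => hdiff x) ?_ (convex_closedBall 0 1)
    intro x hx
    exact hC x hx
  -- positivity of the determinant close to the identity
  have hpos : ∃ δ > 0, ∀ A : E →L[ℝ] E, ‖A‖ < δ → 0 < (1 + A).det := by
    have hcont : Continuous fun A : E →L[ℝ] E => (1 + A).det :=
      ContinuousLinearMap.continuous_det.comp (continuous_const.add continuous_id)
    have : ∀ᶠ A in 𝓝 (0 : E →L[ℝ] E), 0 < (1 + A).det := by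
      apply hcont.continuousAt.eventually
      apply lt_mem_nhds
      simp [ContinuousLinearMap.det]
    obtain ⟨δ, hδ, h⟩ := Metric.eventually_nhds_iff.1 this
    exact ⟨δ, hδ, fun A hA => h (by simpa using hA)⟩
  obtain ⟨δ, hδ, hdet⟩ := hpos
  set m := min δ 1 / (C + 1) with hm
  have hm0 : 0 < m := by positivity
  have hmC : m * C < min δ 1 := by
    rw [hm, div_mul_eq_mul_div, div_lt_iff₀ (by positivity)]
    have : 0 < min δ 1 := by positivity
    nlinarith
  let t : ℕ → ℝ := fun i => m / (i + 1)
  have ht0 : ∀ i, 0 < t i := fun i => by positivity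
  have htm : ∀ i, t i ≤ m := fun i => div_le_self hm0.le (by linarith [(Nat.cast_nonneg i : (0:ℝ) ≤ i)])
  have htC : ∀ i, t i * C < min δ 1 := fun i =>
    (mul_le_mul_of_nonneg_right (htm i) hC0).trans_lt hmC
  have htinj : Function.Injective t := by
    intro i j hij
    simp only [t] at hij
    rw [div_eq_div_iff (by positivity) (by positivity)] at hij
    have := mul_left_cancel₀ hm0.ne' hij
    exact_mod_cast (by linarith : (i:ℝ) = j)
  obtain ⟨w, N, hw1, hw⟩ := exists_weights (E := E) t htinj
  have hI : ∀ i, ∫ x in ball (0:E) 1, (1 + t i • fderiv ℝ u x).det ∂μ = μ.real (ball 0 1) := by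
    intro i
    obtain ⟨hinj, himg⟩ := image_ball hLip hu0 (ht0 i).le ((htC i).trans_le (min_le_right _ _))
    have hd : ∀ x ∈ ball (0:E) 1, HasFDerivWithinAt (fun x => x + t i • u x)
        (1 + t i • fderiv ℝ u x) (ball 0 1) x := by
      intro x _
      exact ((hasFDerivAt_id x).add ((hdiff x).hasFDerivAt.const_smul (t i))).hasFDerivWithinAt
    have := MeasureTheory.integral_image_eq_integral_abs_det_fderiv_smul μ measurableSet_ball hd hinj
      (fun _ => (1:ℝ))
    rw [himg] at this
    simp only [smul_eq_mul, mul_one, MeasureTheory.integral_const, MeasureTheory.measureReal_restrict_apply_univ] at this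
    rw [this]
    refine MeasureTheory.setIntegral_congr_fun measurableSet_ball fun x hx => ?_
    refine (abs_of_pos (hdet _ ?_)).symm
    rw [norm_smul, Real.norm_of_nonneg (ht0 i).le]
    exact (mul_le_mul_of_nonneg_left (hC x (ball_subset_closedBall hx)) (ht0 i).le).trans_lt
      ((htC i).trans_le (min_le_left _ _))
  have hint : ∀ i, MeasureTheory.IntegrableOn (fun x => (1 + t i • fderiv ℝ u x).det) (ball (0:E) 1) μ := by
    intro i
    have hc2 : Continuous fun x => t i • fderiv ℝ u x := by fun_prop
    have : Continuous (fun x => (1 + t i • fderiv ℝ u x).det) :=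
      ContinuousLinearMap.continuous_det.comp (continuous_const.add hc2)
    exact (this.continuousOn.integrableOn_compact hcomp).mono_set ball_subset_closedBall
  have hsum : ∫ x in ball (0:E) 1, (1 + fderiv ℝ u x).det ∂μ = μ.real (ball 0 1) := by
    have e : ∀ x, (1 + fderiv ℝ u x).det = _ := fun x => hw (fderiv ℝ u x)
    rw [MeasureTheory.setIntegral_congr_fun measurableSet_ball (fun x _ => e x)]
    rw [MeasureTheory.integral_finsetSum _ (fun i _ => (hint i).const_mul (w i))]
    simp_rw [MeasureTheory.integral_const_mul, hI, ← Finset.sum_mul, hw1, one_mul]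
  have hzero : ∀ x, (1 + fderiv ℝ u x).det = 0 := by
    intro x
    have hfd : Differentiable ℝ f := hf.differentiable one_ne_zero
    have e : 1 + fderiv ℝ u x = fderiv ℝ f x := by
      have : HasFDerivAt u (fderiv ℝ f x - 1) x := (hfd x).hasFDerivAt.sub (hasFDerivAt_id x)
      rw [this.fderiv]; abel
    rw [e]
    by_contra hne
    have hsq : (fun y => inner ℝ (f y) (f y)) = fun _ => (1:ℝ) := by
      funext y; rw [real_inner_self_eq_norm_sq, h1]; norm_num
    have hD := ((hfd x).hasFDerivAt.inner ℝ (hfd x).hasFDerivAt)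
    rw [hsq] at hD
    have h0 := hD.unique (hasFDerivAt_const (1:ℝ) x)
    have horth : ∀ v, inner ℝ (f x) (fderiv ℝ f x v) = 0 := by
      intro v
      have := congrArg (fun L => L v) h0
      simp [fderivInnerCLM_apply, real_inner_comm] at this
      linarith [this, real_inner_comm (f x) (fderiv ℝ f x v)]
    have hs : Function.Surjective (fderiv ℝ f x) :=
      (LinearMap.equivOfDetNeZero (fderiv ℝ f x : E →ₗ[ℝ] E) hne).surjective
    obtain ⟨v, hv⟩ := hs (f x)
    have := horth v
    rw [hv, real_inner_self_eq_norm_sq, h1] at this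
    norm_num at this
  simp only [hzero, MeasureTheory.integral_zero] at hsum
  have : 0 < μ.real (ball (0:E) 1) := by
    rw [MeasureTheory.measureReal_def]
    exact ENNReal.toReal_pos (measure_ball_pos μ 0 one_pos).ne' MeasureTheory.measure_ball_lt_top.ne
  linarith

/-- The inclusion of the sphere into the punctured space has no nonvanishing extension. -/
theorem no_extension {F : E → E} (hF : Continuous F) (h0 : ∀ x, F x ≠ 0)
    (hout : ∀ x, 1 / 2 < ‖x‖ → F x = ‖x‖⁻¹ • x) : False := by
  have hUopen : IsOpen {x : E | 1 / 2 < ‖x‖} := isOpen_lt continuous_const continuous_norm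
  have hsub : {x : E | 1 ≤ ‖x‖} ⊆ {x : E | 1 / 2 < ‖x‖} := fun x hx => by
    simp only [mem_ofPred_eq] at *; linarith
  obtain ⟨g, hg, hd, he, -⟩ := hF.exists_contDiff_approx_and_eqOn 1 (ε := fun x => ‖F x‖)
    hF.norm (fun x => norm_pos_iff.2 (h0 x)) (S := {x : E | 1 ≤ ‖x‖}) (U := {x : E | 1 / 2 < ‖x‖})
    (isClosed_le continuous_const continuous_norm) (hUopen.mem_nhdsSet.2 hsub) (by
      refine ContDiffOn.congr (f := fun x => ‖x‖⁻¹ • x) ?_ (fun x hx => hout x hx)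
      intro x hx
      have hx0 : x ≠ 0 := by rintro rfl; simp at hx; linarith
      exact (((contDiffAt_norm ℝ hx0).inv (norm_ne_zero_iff.2 hx0)).smul
        contDiffAt_id).contDiffWithinAt)
  have hg0 : ∀ x, g x ≠ 0 := by
    intro x hx
    have := hd x
    simp [hx] at this
  refine no_smooth_retraction (f := fun x => ‖g x‖⁻¹ • g x) ?_ ?_ ?_
  · exact ((hg.norm ℝ hg0).inv (fun x => norm_ne_zero_iff.2 (hg0 x))).smul hg
  · intro x
    rw [norm_smul, norm_inv, norm_norm, inv_mul_cancel₀ (norm_ne_zero_iff.2 (hg0 x))]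
  · intro x hx
    have : g x = x := by
      rw [he (show (1:ℝ) ≤ ‖x‖ by rw [hx]), hout x (by rw [hx]; norm_num), hx]; simp
    simp [this, hx]

/-- The inclusion of the sphere in the punctured space is not nullhomotopic. -/
theorem incl_not_null (ι : C(sphere (0:E) 1, {v : E // v ≠ 0})) (hι : ∀ x, (ι x : E) = x)
    (w : {v : E // v ≠ 0}) (h : ι.Homotopic (ContinuousMap.const _ w)) : False := by
  obtain ⟨H⟩ := h
  classical
  let nrm : {v : E // v ≠ 0} → sphere (0:E) 1 := fun v => ⟨‖v.1‖⁻¹ • v.1, by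
    simp [norm_smul, inv_mul_cancel₀ (norm_ne_zero_iff.2 v.2)]⟩
  have hnrm : Continuous nrm := by
    refine Continuous.subtype_mk ?_ _
    exact (continuous_subtype_val.norm.inv₀ (fun v => norm_ne_zero_iff.2 v.2)).smul
      continuous_subtype_val
  let τ : E → unitInterval := fun x => Set.projIcc 0 1 zero_le_one (2 - 4 * ‖x‖)
  have hτ : Continuous τ := continuous_projIcc.comp (by fun_prop)
  let F : E → E := fun x => if hx : x ≠ 0 then (H (τ x, nrm ⟨x, hx⟩)).1 else w.1
  have hF0 : ∀ x (hx : x ≠ 0), F x = (H (τ x, nrm ⟨x, hx⟩)).1 := fun x hx => dif_pos hx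
  refine no_extension (F := F) ?_ ?_ ?_
  · rw [continuous_iff_continuousAt]
    intro x
    by_cases hx : x = 0
    · have : F =ᶠ[𝓝 x] fun _ => w.1 := by
        filter_upwards [Metric.ball_mem_nhds x (show (0:ℝ) < 1/4 by norm_num)] with y hy
        by_cases hy0 : y = 0
        · simp [F, hy0]
        · rw [hF0 y hy0]
          have : τ y = 1 := by
            apply Set.projIcc_of_right_le
            rw [hx] at hy
            simp at hy; linarith
          rw [this]; simp
      exact continuousAt_const.congr this.symm
    · have hopen : IsOpen {v : E | v ≠ 0} := isOpen_ne
      have : ContinuousOn F {v : E | v ≠ 0} := by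
        rw [continuousOn_iff_continuous_domRestrict]
        have : Continuous (fun v : {v : E // v ≠ 0} => (H (τ v.1, nrm v)).1) :=
          continuous_subtype_val.comp (H.continuous.comp
            ((hτ.comp continuous_subtype_val).prodMk hnrm))
        refine (this.comp (Continuous.subtype_mk continuous_subtype_val
          (fun v : {v : E | v ≠ 0} => v.2))).congr ?_
        intro v
        exact (hF0 v.1 v.2).symm
      exact this.continuousAt (hopen.mem_nhds hx)
  · intro x
    by_cases hx : x = 0
    · simp only [F, hx]; simpa using w.2
    · rw [hF0 x hx]; exact (H _).2
  · intro x hx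
    have hx0 : x ≠ 0 := by rintro rfl; simp at hx; linarith
    rw [hF0 x hx0]
    have : τ x = 0 := by
      apply Set.projIcc_of_le_left
      linarith
    rw [this, H.apply_zero, hι]
end Analytic
section Lift
variable {X V : Type*} [UniformSpace X] [CompactSpace X] [NormedAddCommGroup V] [NormedSpace ℝ V]

/-- Lifting of a homotopy of projectors. -/
lemma lift_projectors (T : unitInterval × X → V →L[ℝ] V) (hT : Continuous T)
    (hid : ∀ p v, T p (T p v) = T p v) (h0 : C(X, {v : V // v ≠ 0}))
    (hh : ∀ x, T (0, x) (h0 x).1 = (h0 x).1) :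
    ∃ h1 : C(X, {v : V // v ≠ 0}), h0.Homotopic h1 ∧ ∀ x, T (1, x) (h1 x).1 = (h1 x).1 := by
  have huc := CompactSpace.uniformContinuous_of_continuous hT
  have hev : ∃ δ > 0, ∀ s t : unitInterval, dist s t < δ → ∀ x, dist (T (s, x)) (T (t, x)) < 1 := by
    have h1 := huc (Metric.dist_mem_uniformity one_pos)
    rw [Filter.mem_map, uniformity_prod_eq_comap_prod, Filter.mem_comap] at h1
    obtain ⟨A, hA, hsub⟩ := h1
    obtain ⟨B, hB, C, hC, hBC⟩ := Filter.mem_prod_iff.1 hA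
    obtain ⟨δ, hδ, hδB⟩ := Metric.mem_uniformity_dist.1 hB
    refine ⟨δ, hδ, fun s t hst x => ?_⟩
    have : (((s, x), (t, x)) : (unitInterval × X) × (unitInterval × X)) ∈ _ :=
      hsub (show _ ∈ A from hBC ⟨hδB hst, refl_mem_uniformity hC⟩)
    exact this
  obtain ⟨δ, hδ, hclose⟩ := hev
  obtain ⟨N, hN⟩ := exists_nat_one_div_lt hδ
  let τ : ℕ → unitInterval := fun k => Set.projIcc 0 1 zero_le_one ((k : ℝ) / (N + 1))
  have hτ : ∀ k, dist (τ (k+1)) (τ k) < δ := by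
    intro k
    refine lt_of_le_of_lt ?_ hN
    rw [Subtype.dist_eq, Real.dist_eq]
    refine (Set.abs_projIcc_sub_projIcc zero_le_one).trans ?_
    rw [← sub_div]
    push_cast
    rw [add_sub_cancel_left, abs_of_pos (by positivity)]
  have key : ∀ k, ∃ h1 : C(X, {v : V // v ≠ 0}), h0.Homotopic h1 ∧
      ∀ x, T (τ k, x) (h1 x).1 = (h1 x).1 := by
    intro k
    induction k with
    | zero =>
      refine ⟨h0, ContinuousMap.Homotopic.refl _, fun x => ?_⟩
      have : τ 0 = 0 := by apply Set.projIcc_of_le_left; simp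
      rw [this, hh]
    | succ k ih =>
      obtain ⟨h, hhom, hfix⟩ := ih
      have hlt : ∀ x, ‖T (τ (k+1), x) (h x).1 - (h x).1‖ < ‖(h x).1‖ := by
        intro x
        conv_lhs => rw [← hfix x, hfix x]
        have hd := hclose _ _ (hτ k) x
        rw [dist_eq_norm] at hd
        have e : T (τ (k+1), x) (h x).1 - (h x).1 = (T (τ (k+1), x) - T (τ k, x)) (h x).1 := by
          rw [sub_apply, hfix]
        rw [e]
        refine (ContinuousLinearMap.le_opNorm _ _).trans_lt ?_
        have := norm_pos_iff.2 (h x).2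
        nlinarith
      have hne : ∀ (s : unitInterval) x,
          (h x).1 + (s : ℝ) • (T (τ (k+1), x) (h x).1 - (h x).1) ≠ 0 := by
        intro s x h0
        have h1 : (h x).1 = - ((s : ℝ) • (T (τ (k+1), x) (h x).1 - (h x).1)) :=
          eq_neg_of_add_eq_zero_left h0
        have h2 := congrArg norm h1
        rw [norm_neg, norm_smul, Real.norm_of_nonneg s.2.1] at h2
        have := hlt x
        have := mul_le_of_le_one_left (norm_nonneg (T (τ (k+1), x) (h x).1 - (h x).1)) s.2.2
        linarith
      have hcT : Continuous fun x => T (τ (k+1), x) (h x).1 :=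
        (hT.comp (by fun_prop : Continuous fun x => (τ (k+1), x))).clm_apply
          (continuous_subtype_val.comp h.continuous)
      have hne1 : ∀ x, T (τ (k+1), x) (h x).1 ≠ 0 := fun x => by
        have := hne 1 x; simpa using this
      let h' : C(X, {v : V // v ≠ 0}) := ⟨fun x => ⟨T (τ (k+1), x) (h x).1, hne1 x⟩,
        hcT.subtype_mk hne1⟩
      refine ⟨h', hhom.trans ⟨⟨⟨fun p => ⟨(h p.2).1 + (p.1 : ℝ) • (T (τ (k+1), p.2) (h p.2).1 - (h p.2).1),
        hne p.1 p.2⟩, ?_⟩, ?_, ?_⟩⟩, fun x => hid _ _⟩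
      · refine Continuous.subtype_mk ?_ _
        have c1 : Continuous fun p : unitInterval × X => (h p.2).1 :=
          continuous_subtype_val.comp (h.continuous.comp continuous_snd)
        exact c1.add ((continuous_subtype_val.comp continuous_fst).smul
          ((hcT.comp continuous_snd).sub c1))
      · intro x; apply Subtype.ext; simp
      · intro x; apply Subtype.ext; simp [h']
  obtain ⟨h1, hhom, hfix⟩ := key (N + 1)
  refine ⟨h1, hhom, fun x => ?_⟩
  have : τ (N + 1) = 1 := by
    apply Set.projIcc_of_right_le
    push_cast
    rw [div_self (by positivity)]
  rw [← this]; exact hfix x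

end Lift

abbrev HopfV := EuclideanSpace ℂ (Fin 2)

def hopfMat (y : E3) : Matrix (Fin 2) (Fin 2) ℂ :=
  !![(1 + (y 2 : ℂ)) / 2, ((y 0 : ℂ) + (y 1 : ℂ) * Complex.I) / 2;
     ((y 0 : ℂ) - (y 1 : ℂ) * Complex.I) / 2, (1 - (y 2 : ℂ)) / 2]

def hopfCLM (y : E3) : HopfV →L[ℂ] HopfV := Matrix.toEuclideanCLM (n := Fin 2) (𝕜 := ℂ) (hopfMat y)

lemma hopfCLM_zero (y : E3) (v : HopfV) : hopfCLM y v 0 =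
    (1 + (y 2 : ℂ)) / 2 * v 0 + ((y 0 : ℂ) + (y 1 : ℂ) * Complex.I) / 2 * v 1 := by
  simp [hopfCLM, hopfMat, Matrix.mulVec, dotProduct, Fin.sum_univ_two]

lemma hopfCLM_one (y : E3) (v : HopfV) : hopfCLM y v 1 =
    ((y 0 : ℂ) - (y 1 : ℂ) * Complex.I) / 2 * v 0 + (1 - (y 2 : ℂ)) / 2 * v 1 := by
  simp [hopfCLM, hopfMat, Matrix.mulVec, dotProduct, Fin.sum_univ_two]

lemma continuous_hopfCLM : Continuous hopfCLM := by
  have h1 : Continuous hopfMat := by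
    apply continuous_matrix
    intro i j
    fin_cases i <;> fin_cases j <;> simp [hopfMat] <;> fun_prop
  have h2 : Continuous (Matrix.toEuclideanCLM (n := Fin 2) (𝕜 := ℂ)) :=
    LinearMap.continuous_of_finiteDimensional
      ((Matrix.toEuclideanCLM (n := Fin 2) (𝕜 := ℂ)).toAlgEquiv.toLinearMap)
  exact h2.comp h1

lemma sph2_eq (y : Sph2) : ((y.1 0 : ℂ)) ^ 2 + (y.1 1 : ℂ) ^ 2 + (y.1 2 : ℂ) ^ 2 = 1 := by
  have h : ‖y.1‖ = 1 := by simpa using y.2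
  have h2 := EuclideanSpace.norm_sq_eq y.1
  rw [h, Fin.sum_univ_three] at h2
  simp only [Real.norm_eq_abs, sq_abs] at h2
  have h3 : (y.1 0) ^ 2 + (y.1 1) ^ 2 + (y.1 2) ^ 2 = 1 := by linarith
  have h4 := congrArg (fun r : ℝ => (r : ℂ)) h3
  simpa only [Complex.ofReal_add, Complex.ofReal_pow, Complex.ofReal_one] using h4

lemma hopfCLM_idem (y : Sph2) (v : HopfV) : hopfCLM y (hopfCLM y v) = hopfCLM y v := by
  have h := sph2_eq y
  have hI := Complex.I_sq
  ext i
  fin_cases i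
  · simp only [Fin.zero_eta, Fin.mk_one, hopfCLM_zero, hopfCLM_one]
    linear_combination (v 0 / 4) * h - (v 0 / 4) * (y.1 1 : ℂ) ^ 2 * hI
  · simp only [Fin.zero_eta, Fin.mk_one, hopfCLM_zero, hopfCLM_one]
    linear_combination (v 1 / 4) * h - (v 1 / 4) * (y.1 1 : ℂ) ^ 2 * hI

lemma exists_hopf_ker (y : Sph2) : ∃ w : HopfV, w ≠ 0 ∧ hopfCLM y w = 0 := by
  by_contra! hcon
  have hall : ∀ v, hopfCLM y v = v := by
    intro v
    by_contra hne
    exact hcon (hopfCLM y v - v) (sub_ne_zero.2 hne) (by rw [map_sub, hopfCLM_idem, sub_self])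
  have h0 := congrArg (fun v : HopfV => v 0) (hall (!₂[1, 0]))
  have h1 := congrArg (fun v : HopfV => v 1) (hall (!₂[0, 1]))
  simp only [hopfCLM_zero, hopfCLM_one] at h0 h1
  simp at h0 h1
  have : (1 : ℂ) = 2 := by linear_combination h0 + h1
  norm_num at this

lemma hopf_fix (z : Sph3c) (y : E3)
    (h0 : y 0 = (2 * (z.1 0 * (starRingEnd ℂ) (z.1 1))).re)
    (h1 : y 1 = (2 * (z.1 0 * (starRingEnd ℂ) (z.1 1))).im)
    (h2 : y 2 = ‖z.1 0‖ ^ 2 - ‖z.1 1‖ ^ 2) : hopfCLM y z.1 = z.1 := by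
  have hn : ‖z.1‖ = 1 := by simpa using z.2
  have hn2 := EuclideanSpace.norm_sq_eq z.1
  rw [hn, Fin.sum_univ_two] at hn2
  have hnC : z.1 0 * (starRingEnd ℂ) (z.1 0) + z.1 1 * (starRingEnd ℂ) (z.1 1) = 1 := by
    rw [Complex.mul_conj', Complex.mul_conj']
    have h3 : ‖z.1 0‖ ^ 2 + ‖z.1 1‖ ^ 2 = 1 := by linarith
    have h4 := congrArg (fun r : ℝ => (r : ℂ)) h3
    simpa only [Complex.ofReal_add, Complex.ofReal_pow, Complex.ofReal_one] using h4
  have e2 : (y 2 : ℂ) = z.1 0 * (starRingEnd ℂ) (z.1 0) - z.1 1 * (starRingEnd ℂ) (z.1 1) := by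
    rw [Complex.mul_conj', Complex.mul_conj', h2]; push_cast; ring
  have ea : (y 0 : ℂ) + (y 1 : ℂ) * Complex.I = 2 * (z.1 0 * (starRingEnd ℂ) (z.1 1)) := by
    rw [h0, h1, Complex.re_add_im]
  have eb : (y 0 : ℂ) - (y 1 : ℂ) * Complex.I = 2 * (z.1 1 * (starRingEnd ℂ) (z.1 0)) := by
    have := congrArg (starRingEnd ℂ) ea
    simp at this
    rw [sub_eq_add_neg, this, map_ofNat]; ring
  ext i
  fin_cases i
  · simp only [Fin.zero_eta, Fin.mk_one, hopfCLM_zero, hopfCLM_one, ea, eb, e2]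
    linear_combination (z.1 0 / 2) * hnC
  · simp only [Fin.zero_eta, Fin.mk_one, hopfCLM_zero, hopfCLM_one, ea, eb, e2]
    linear_combination (z.1 1 / 2) * hnC

/-- The Hopf map `ζ : S³ → S²`, sending `(z₁, z₂) ∈ S³ ⊂ ℂ²` to the point
of `S²` corresponding to `[z₁ : z₂] ∈ ℂP¹` (explicitly
`ζ(z₁,z₂) = (Re(2 z₁ z̄₂), Im(2 z₁ z̄₂), |z₁|² − |z₂|²)`), is not homotopic to a
constant map. -/
theorem hopf_map_not_nullhomotopic (ζ : C(Sph3c, Sph2))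
    (hζ : ∀ z : Sph3c,
      ((ζ z : E3) 0 = (2 * (z.1 0 * (starRingEnd ℂ) (z.1 1))).re) ∧
      ((ζ z : E3) 1 = (2 * (z.1 0 * (starRingEnd ℂ) (z.1 1))).im) ∧
      ((ζ z : E3) 2 = ‖z.1 0‖ ^ 2 - ‖z.1 1‖ ^ 2)) :
    ¬ ∃ c : Sph2, ζ.Homotopic (ContinuousMap.const Sph3c c) := by
  rintro ⟨c, ⟨H⟩⟩
  let T : unitInterval × Sph3c → HopfV →L[ℝ] HopfV :=
    fun p => (hopfCLM (H p).1).restrictScalars ℝ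
  have hT : Continuous T :=
    (ContinuousLinearMap.continuous_restrictScalars ℝ).comp
      (continuous_hopfCLM.comp (continuous_subtype_val.comp H.continuous))
  let ι : C(Sph3c, {v : HopfV // v ≠ 0}) :=
    ⟨fun z => ⟨z.1, ne_zero_of_mem_unit_sphere z⟩, continuous_subtype_val.subtype_mk _⟩
  obtain ⟨h1, hhom, hfix⟩ := lift_projectors T hT (fun p v => hopfCLM_idem (H p) v) ι (by
    intro z
    obtain ⟨a, b, d⟩ := hζ z
    have : H (0, z) = ζ z := H.apply_zero z
    change hopfCLM (H (0, z)).1 z.1 = z.1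
    rw [this]
    exact hopf_fix z _ a b d)
  have hfix' : ∀ z, hopfCLM c.1 (h1 z).1 = (h1 z).1 := by
    intro z
    have h := hfix z
    change hopfCLM (H (1, z)).1 (h1 z).1 = (h1 z).1 at h
    rwa [show H (1, z) = c from H.apply_one z] at h
  obtain ⟨w, hw, hcw⟩ := exists_hopf_ker c
  have hne : ∀ (s : unitInterval) z, (1 - (s : ℝ)) • (h1 z).1 + (s : ℝ) • w ≠ 0 := by
    intro s z h
    have h2 := congrArg ((hopfCLM c.1).restrictScalars ℝ) h
    rw [map_add, map_smul, map_smul, map_zero] at h2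
    simp only [ContinuousLinearMap.coe_restrictScalars', hcw, hfix', smul_zero, add_zero] at h2
    rcases smul_eq_zero.1 h2 with h3 | h3
    · have : (s : ℝ) = 1 := by linarith
      rw [this] at h
      simp at h
      exact hw h
    · exact (h1 z).2 h3
  refine incl_not_null ι (fun _ => rfl) ⟨w, hw⟩ (hhom.trans
    ⟨⟨⟨fun p => ⟨(1 - (p.1 : ℝ)) • (h1 p.2).1 + (p.1 : ℝ) • w, hne p.1 p.2⟩, ?_⟩, ?_, ?_⟩⟩)
  · refine Continuous.subtype_mk ?_ _
    have c1 : Continuous fun p : unitInterval × Sph3c => (h1 p.2).1 :=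
      continuous_subtype_val.comp (h1.continuous.comp continuous_snd)
    have c2 : Continuous fun p : unitInterval × Sph3c => (p.1 : ℝ) :=
      continuous_subtype_val.comp continuous_fst
    exact ((continuous_const.sub c2).smul c1).add (c2.smul continuous_const)
  · intro z; apply Subtype.ext; simp
  · intro z; apply Subtype.ext; simp
end
end
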